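/- arXiv:2006.07948 — 2 statements merged into one kernel-verified Lean document; each statement's English description precedes it below -/
import Mathlib

section
/- Let p ∈ (1,∞), n ≥ 2, k ∈ {0,1,…,n−1}, and −∞ < a_i < b_i < ∞ for i = 1,…,n−k; set D = ℝ^k × ∏_{i=1}^{n−k}(a_i,b_i) ⊆ ℝⁿ. Then the infimum of the Rayleigh quotient ‖|∇u|_{ℓ^p}‖_{L^p(D)}^p / ‖u‖_{L^p(D)}^p over all nonzero u ∈ W_0^{1,p}(D) equals π_p^p (p−1) Σ_{i=1}^{n−k} (b_i−a_i)^{−p}. -/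
open MeasureTheory ENNReal Set Filter Topology

noncomputable section

/-- The `i`-th partial derivative of `u : ℝⁿ → ℝ`. -/
def pder {n : ℕ} (i : Fin n) (u : (Fin n → ℝ) → ℝ) (x : Fin n → ℝ) : ℝ :=
  fderiv ℝ u x (Pi.single i 1)

/-- `u` is a smooth function compactly supported in the open set `D`. -/
def IsTestFun {n : ℕ} (D : Set (Fin n → ℝ)) (u : (Fin n → ℝ) → ℝ) : Prop :=
  ContDiff ℝ (⊤ : ℕ∞) u ∧ HasCompactSupport u ∧ tsupport u ⊆ D

/-- The strip-like domain `ℝᵏ × ∏_{i ≥ k} (aᵢ, bᵢ)`, realized as a subset of `ℝⁿ`: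
the coordinates `i < k` are free, the coordinates `i ≥ k` are constrained to `(aᵢ, bᵢ)`. -/
def stripDomain (n k : ℕ) (a b : Fin n → ℝ) : Set (Fin n → ℝ) :=
  {x | ∀ i : Fin n, k ≤ (i : ℕ) → x i ∈ Set.Ioo (a i) (b i)}

/-- The ambient space `V = L^p(ℝⁿ; ℓ^p(ℝ^{n+1}))`, in which the Sobolev space `W^{1,p}_0`
is realized as the closure of the set of "jets" `(u, ∇u)` of test functions. -/
abbrev Vsp (n : ℕ) (p : ℝ≥0∞) [Fact (1 ≤ p)] :=
  Lp (PiLp p (fun _ : Fin (n + 1) => ℝ)) p (volume : Measure (Fin n → ℝ))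

/-- The "jet" `(u, ∂₁u, …, ∂ₙu)` of a function, valued in `ℓ^p(ℝ^{n+1})`. -/
def jet {n : ℕ} (p : ℝ≥0∞) (u : (Fin n → ℝ) → ℝ) (x : Fin n → ℝ) :
    PiLp p (fun _ : Fin (n + 1) => ℝ) :=
  (WithLp.equiv p (∀ _ : Fin (n + 1), ℝ)).symm (Fin.cons (u x) (fun i => pder i u x))

/-- `W^{1,p}_0(D)` realized as a closed subspace of `V`:
the closure of the subspace of jets of test functions supported in `D`.
The (subspace) norm of the jet of `u` is exactly
`(‖u‖_p^p + ‖ |∇u|_{ℓ^p} ‖_p^p)^{1/p}`, i.e., the `W^{1,p}`-norm of `u`. -/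
def W0sub {n : ℕ} (p : ℝ≥0∞) [Fact (1 ≤ p)] (D : Set (Fin n → ℝ)) : Submodule ℝ (Vsp n p) :=
  (Submodule.span ℝ {f : Vsp n p | ∃ u : (Fin n → ℝ) → ℝ, IsTestFun D u ∧
    (f : (Fin n → ℝ) → PiLp p (fun _ : Fin (n + 1) => ℝ)) =ᵐ[volume] jet p u}).topologicalClosure

instance W0sub.completeSpace {n : ℕ} (p : ℝ≥0∞) [Fact (1 ≤ p)] (D : Set (Fin n → ℝ)) :
    CompleteSpace (W0sub (n := n) p D) :=
  (Submodule.isClosed_topologicalClosure _).completeSpace_coe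

/-- Projection of a jet onto its zeroth (function) component. -/
def proj0 (n : ℕ) (p : ℝ≥0∞) [Fact (1 ≤ p)] : PiLp p (fun _ : Fin (n + 1) => ℝ) →L[ℝ] ℝ :=
  (ContinuousLinearMap.proj (0 : Fin (n + 1))).comp
    (PiLp.continuousLinearEquiv p ℝ (fun _ : Fin (n + 1) => ℝ)).toContinuousLinearMap

/-- Projection of a jet onto its gradient components, valued in `ℓ^p(ℝⁿ)`. -/
def projGrad (n : ℕ) (p : ℝ≥0∞) [Fact (1 ≤ p)] :
    PiLp p (fun _ : Fin (n + 1) => ℝ) →L[ℝ] PiLp p (fun _ : Fin n => ℝ) :=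
  ((PiLp.continuousLinearEquiv p ℝ (fun _ : Fin n => ℝ)).symm.toContinuousLinearMap).comp
    ((ContinuousLinearMap.pi fun i : Fin n => ContinuousLinearMap.proj (R := ℝ) i.succ).comp
      (PiLp.continuousLinearEquiv p ℝ (fun _ : Fin (n + 1) => ℝ)).toContinuousLinearMap)

/-- The canonical Sobolev embedding `I : W^{1,p}_0(D) → L^p(D)` (as a map into `L^p(ℝⁿ)`;
all functions in `W^{1,p}_0(D)` vanish a.e. outside `D`). -/
def SobolevEmb {n : ℕ} (p : ℝ≥0∞) [Fact (1 ≤ p)] (D : Set (Fin n → ℝ)) :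
    W0sub (n := n) p D →L[ℝ] Lp ℝ p (volume : Measure (Fin n → ℝ)) :=
  ((proj0 n p).compLpL p volume).comp (W0sub p D).subtypeL

/-- The gradient map `W^{1,p}_0(D) → L^p(D; ℓ^p(ℝⁿ))`, `u ↦ ∇u`. -/
def SobolevGrad {n : ℕ} (p : ℝ≥0∞) [Fact (1 ≤ p)] (D : Set (Fin n → ℝ)) :
    W0sub (n := n) p D →L[ℝ] Lp (PiLp p (fun _ : Fin n => ℝ)) p (volume : Measure (Fin n → ℝ)) :=
  ((projGrad n p).compLpL p volume).comp (W0sub p D).subtypeL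

/-- `π_p = 2 ∫₀¹ (1 - sᵖ)^{-1/p} ds`. -/
def piP (p : ℝ) : ℝ := 2 * ∫ s in (0 : ℝ)..1, (1 - s ^ p) ^ (-1 / p)

/-- The inverse of `t ↦ ∫₀ᵗ (1 - sᵖ)^{-1/p} ds` on `[0,1]`; this is `sin_p` on `[0, π_p/2]`. -/
def sinpHalf (p : ℝ) : ℝ → ℝ :=
  Function.invFunOn (fun t : ℝ => ∫ s in (0 : ℝ)..t, (1 - s ^ p) ^ (-1 / p)) (Set.Icc 0 1)

/-- `sin_p` on `[0, π_p]`, by reflection around `π_p/2`. -/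
def sinpBase (p t : ℝ) : ℝ :=
  if t ≤ piP p / 2 then sinpHalf p t else sinpHalf p (piP p - t)

/-- `sin_p` on `[-π_p, π_p]`, by odd reflection. -/
def sinpSym (p t : ℝ) : ℝ := if 0 ≤ t then sinpBase p t else -sinpBase p (-t)

/-- The generalized sine function `sin_p`, extended `2π_p`-periodically to all of `ℝ`. -/
def sinp (p t : ℝ) : ℝ :=
  sinpSym p (t - 2 * piP p * ⌊(t + piP p) / (2 * piP p)⌋)

/-- The generalized cosine function `cos_p = (sin_p)'`. -/
def cosp (p : ℝ) : ℝ → ℝ := deriv (sinp p)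

/-- The `m`-th entropy number of a bounded linear operator: the infimum of all `ε > 0` such
that the image of the closed unit ball can be covered by `2^{m-1}` balls of radius `ε`. -/
def entropyNumber {X Y : Type*} [NormedAddCommGroup X] [NormedSpace ℝ X]
    [NormedAddCommGroup Y] [NormedSpace ℝ Y] (m : ℕ) (T : X →L[ℝ] Y) : ℝ :=
  sInf {ε : ℝ | 0 < ε ∧ ∃ c : Fin (2 ^ (m - 1)) → Y,
    ∀ x : X, ‖x‖ ≤ 1 → ∃ j, ‖T x - c j‖ ≤ ε}

end

theorem intervalIntegrable_one_sub_rpow {p : ℝ} (hp : 1 < p) :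
    IntervalIntegrable (fun s : ℝ => (1 - s ^ p) ^ (-1 / p)) volume 0 1 := by
  have hp0 : 0 < p := by linarith
  have h1 : IntervalIntegrable (fun s : ℝ => s ^ (-1 / p)) volume 1 0 :=
    intervalIntegral.intervalIntegrable_rpow' (by rw [lt_div_iff₀ hp0]; linarith)
  have h2 := h1.comp_sub_left 1
  simp only [sub_self, sub_zero] at h2
  refine h2.mono_fun
    ((measurable_const.sub (measurable_id.pow_const p)).pow_const _).aestronglyMeasurable ?_
  rw [EventuallyLE, ae_restrict_iff' measurableSet_uIoc]
  have h3 : ∀ᵐ s : ℝ, s ≠ 1 := by simp [ae_iff, measure_singleton]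
  filter_upwards [h3] with s hs1 hs
  rw [uIoc_of_le zero_le_one] at hs
  have hs' : s < 1 := lt_of_le_of_ne hs.2 hs1
  have h4 : s ^ p ≤ s := by
    simpa using Real.rpow_le_rpow_of_exponent_ge hs.1 hs.2 hp.le
  have h5 : 0 ≤ (1 - s) := by linarith
  rw [Real.norm_of_nonneg (Real.rpow_nonneg (by linarith) _),
    Real.norm_of_nonneg (Real.rpow_nonneg h5 _)]
  apply Real.rpow_le_rpow_of_nonpos (by linarith) (by linarith)
  rw [div_le_iff₀ hp0]; linarith

/-- The first quarter period of `sin_p`, together with its defining differential equation. -/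
theorem exists_quarter_sinp {p : ℝ} (hp : 1 < p) :
    0 < piP p ∧ ∃ S : ℝ → ℝ, Continuous S ∧ S 0 = 0 ∧ S (piP p / 2) = 1 ∧
      ∀ x ∈ Ioo 0 (piP p / 2), S x ∈ Ioo 0 1 ∧ HasDerivAt S ((1 - S x ^ p) ^ (1 / p)) x := by
  have hp0 : 0 < p := by linarith
  set g : ℝ → ℝ := fun s => (1 - s ^ p) ^ (-1 / p) with hg
  set f : ℝ → ℝ := fun s => 1 + (Ioo 0 1).indicator (fun s => g s - 1) s with hf
  have hlt : ∀ s ∈ Ioo (0 : ℝ) 1, 0 < 1 - s ^ p := fun s hs => by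
    have := Real.rpow_lt_one hs.1.le hs.2 hp0
    linarith
  have hf1 : ∀ s, 1 ≤ f s := by
    intro s
    have : 0 ≤ (Ioo 0 1).indicator (fun s => g s - 1) s := by
      apply indicator_nonneg
      intro s hs
      have h1 : 1 - s ^ p ≤ 1 := by
        have := Real.rpow_nonneg hs.1.le p
        linarith
      have := Real.one_le_rpow_of_pos_of_le_one_of_nonpos (hlt s hs) h1
        (z := -1 / p) (by rw [div_le_iff₀ hp0]; linarith)
      simp only [hg]; linarith
    simp only [hf]; linarith
  have hfg : ∀ s ∈ Ioo (0 : ℝ) 1, f s = g s := by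
    intro s hs
    simp [hf, indicator_of_mem hs]
  have hfi : ∀ c d, IntervalIntegrable f volume c d := by
    intro c d
    refine (intervalIntegrable_const (c := (1 : ℝ))).add ?_
    apply Integrable.intervalIntegrable
    rw [integrable_indicator_iff measurableSet_Ioo, ← intervalIntegrable_iff_integrableOn_Ioo_of_le
      zero_le_one]
    exact (intervalIntegrable_one_sub_rpow hp).sub intervalIntegrable_const
  set F : ℝ → ℝ := fun t => ∫ s in (0 : ℝ)..t, f s with hF
  have hFc : Continuous F := intervalIntegral.continuous_primitive hfi 0
  have hFle : ∀ c d, c ≤ d → d - c ≤ F d - F c := by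
    intro c d hcd
    simp only [hF]
    rw [intervalIntegral.integral_interval_sub_left (hfi _ _) (hfi _ _)]
    have := intervalIntegral.integral_mono_on hcd (intervalIntegrable_const (c := (1 : ℝ)))
      (hfi c d) (fun x _ => hf1 x)
    simpa using this
  have hFm : StrictMono F := fun c d hcd => by
    have := hFle c d hcd.le
    linarith
  have hF0 : F 0 = 0 := by simp [hF]
  have hF1 : F 1 = piP p / 2 := by
    simp only [hF, piP]
    rw [mul_div_cancel_left₀ _ two_ne_zero]
    apply intervalIntegral.integral_congr_ae
    have h3 : ∀ᵐ s : ℝ, s ≠ 1 := by simp [ae_iff, measure_singleton]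
    filter_upwards [h3] with s hs1 hs
    rw [uIoc_of_le zero_le_one] at hs
    exact hfg s ⟨hs.1, lt_of_le_of_ne hs.2 hs1⟩
  have hFs : Function.Surjective F := by
    apply hFc.surjective
    · refine tendsto_atTop_mono' _ ?_ tendsto_id
      filter_upwards [eventually_ge_atTop 0] with x hx
      have := hFle 0 x hx
      simp only [id]; linarith
    · refine tendsto_atBot_mono' _ ?_ tendsto_id
      filter_upwards [eventually_le_atBot 0] with x hx
      have := hFle x 0 hx
      simp only [id]; linarith
  have hpi : 0 < piP p := by
    have := hFle 0 1 zero_le_one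
    linarith
  let e := hFm.orderIsoOfSurjective F hFs
  have he : ∀ x, e x = F x := fun x => rfl
  refine ⟨hpi, e.symm, e.symm.continuous, ?_, ?_, ?_⟩
  · rw [e.symm_apply_eq, he, hF0]
  · rw [e.symm_apply_eq, he, hF1]
  · intro x hx
    have hS : e.symm x ∈ Ioo (0 : ℝ) 1 := by
      constructor
      · rw [← e.lt_iff_lt, e.apply_symm_apply, he, hF0]; exact hx.1
      · rw [← e.lt_iff_lt, e.apply_symm_apply, he, hF1]; exact hx.2
    refine ⟨hS, ?_⟩
    have hgc : ContinuousOn g (Ioo 0 1) := by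
      intro s hs
      apply ContinuousAt.continuousWithinAt
      have := (hlt s hs).ne'
      have hs0 := hs.1.ne'
      exact (continuousAt_const.sub (Real.continuousAt_rpow_const _ _ (Or.inl hs0))).rpow_const
        (Or.inl this)
    have hfc : ContinuousOn f (Ioo 0 1) := hgc.congr hfg
    have hD : HasDerivAt F (f (e.symm x)) (e.symm x) :=
      intervalIntegral.integral_hasDerivAt_right (hfi _ _)
        (hfc.stronglyMeasurableAtFilter isOpen_Ioo _ hS)
        (hfc.continuousAt (isOpen_Ioo.mem_nhds hS))
    have hne : f (e.symm x) ≠ 0 := by linarith [hf1 (e.symm x)]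
    have := HasDerivAt.of_local_left_inverse (g := e.symm) (a := x)
      e.symm.continuous.continuousAt hD hne (Eventually.of_forall fun y => e.apply_symm_apply y)
    rw [hfg _ hS] at this
    refine this.congr_deriv ?_
    simp only [hg]
    rw [neg_div, Real.rpow_neg (hlt _ hS).le, inv_inv]

/-- The Picone-type pointwise inequality behind the one-dimensional Poincaré inequality. -/
theorem picone_pointwise {p y v w : ℝ} (hp : 1 < p) (hy : y ∈ Ioo (0 : ℝ) 1) :
    -(p - 1) * y ^ (-p) * |v| ^ p +
      (1 - y ^ p) ^ ((p - 1) / p) * y ^ (1 - p) * (p * |v| ^ (p - 2) * v * w) ≤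
      |w| ^ p - (p - 1) * |v| ^ p := by
  have hp0 : 0 < p := by linarith
  have hp1 : 0 < p - 1 := by linarith
  have hA : 0 < 1 - y ^ p := by
    have := Real.rpow_lt_one hy.1.le hy.2 hp0
    linarith
  have hyp := Real.rpow_pos_of_pos hy.1 p
  set h := (1 - y ^ p) ^ ((p - 1) / p) * y ^ (1 - p) with hh
  have hh0 : 0 ≤ h := mul_nonneg (Real.rpow_nonneg hA.le _) (Real.rpow_nonneg hy.1.le _)
  have hconj : p.HolderConjugate (p / (p - 1)) := Real.HolderConjugate.conjExponent hp
  have hY := Real.young_inequality_of_nonneg (abs_nonneg w)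
    (mul_nonneg hh0 (Real.rpow_nonneg (abs_nonneg v) (p - 1))) hconj
  have e1 : (h * |v| ^ (p - 1)) ^ (p / (p - 1)) = (y ^ (-p) - 1) * |v| ^ p := by
    rw [Real.mul_rpow hh0 (Real.rpow_nonneg (abs_nonneg v) _), ← Real.rpow_mul (abs_nonneg v), hh,
      Real.mul_rpow (Real.rpow_nonneg hA.le _) (Real.rpow_nonneg hy.1.le _),
      ← Real.rpow_mul hA.le, ← Real.rpow_mul hy.1.le]
    have a1 : (p - 1) / p * (p / (p - 1)) = 1 := by field_simp
    have a2 : (1 - p) * (p / (p - 1)) = -p := by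
      field_simp; ring
    have a3 : (p - 1) * (p / (p - 1)) = p := by field_simp
    rw [a1, a2, a3, Real.rpow_one, Real.rpow_neg hy.1.le]
    field_simp
  have e2 : |v| ^ (p - 2) * v * w ≤ |v| ^ (p - 1) * |w| := by
    rcases eq_or_ne v 0 with rfl | hv
    · simp; positivity
    · have hv' : 0 < |v| := abs_pos.mpr hv
      calc |v| ^ (p - 2) * v * w ≤ |(|v| ^ (p - 2) * v * w)| := le_abs_self _
        _ = |v| ^ (p - 2) * |v| * |w| := by
          rw [abs_mul, abs_mul, abs_of_nonneg (Real.rpow_nonneg hv'.le _)]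
        _ = |v| ^ (p - 1) * |w| := by
          nth_rewrite 2 [← Real.rpow_one |v|]
          rw [← Real.rpow_add hv']
          congr 2; ring
  rw [e1] at hY
  have e3 := mul_le_mul_of_nonneg_left hY hp0.le
  have e4 : p * (|w| ^ p / p + (y ^ (-p) - 1) * |v| ^ p / (p / (p - 1))) =
      |w| ^ p + (p - 1) * ((y ^ (-p) - 1) * |v| ^ p) := by field_simp
  rw [e4] at e3
  have e5 := mul_le_mul_of_nonneg_left e2 (mul_nonneg hp0.le hh0)
  nlinarith [e3, e5]

theorem poincare_half {p l c : ℝ} {S v : ℝ → ℝ} (hp : 1 < p) (hSc : Continuous S)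
    (hSl : S l = 1)
    (hS : ∀ x ∈ Ioo 0 l, S x ∈ Ioo 0 1 ∧ HasDerivAt S ((1 - S x ^ p) ^ (1 / p)) x)
    (hv : ContDiff ℝ 1 v) (hc : 0 < c) (hcl : c < l) (hvc : v c = 0) :
    (p - 1) * ∫ x in c..l, |v x| ^ p ≤ ∫ x in c..l, |deriv v x| ^ p := by
  have hp0 : 0 < p := by linarith
  have hdv : Continuous (deriv v) := hv.continuous_deriv le_rfl
  have hc1 : Continuous fun x => |v x| ^ p := hv.continuous.abs.rpow_const fun _ => Or.inr hp0.le
  have hc2 : Continuous fun x => |deriv v x| ^ p := hdv.abs.rpow_const fun _ => Or.inr hp0.le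
  set W : ℝ → ℝ := fun x => (1 - S x ^ p) ^ ((p - 1) / p) * S x ^ (1 - p) * |v x| ^ p with hW
  have hSpos : ∀ x ∈ Icc c l, 0 < S x := by
    intro x hx
    rcases eq_or_lt_of_le hx.2 with rfl | h
    · simp [hSl]
    · exact (hS x ⟨hc.trans_le hx.1, h⟩).1.1
  have hWc : ContinuousOn W (Icc c l) := by
    refine ContinuousOn.mul (ContinuousOn.mul ?_ ?_) hc1.continuousOn
    · refine Continuous.continuousOn ?_
      refine (continuous_const.sub (hSc.rpow_const fun _ => Or.inr hp0.le)).rpow_const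
        fun _ => Or.inr ?_
      exact div_nonneg (by linarith) hp0.le
    · exact hSc.continuousOn.rpow_const fun x hx => Or.inl (hSpos x hx).ne'
  have hWd : ∀ x ∈ Ioo c l, HasDerivAt W (-(p - 1) * S x ^ (-p) * |v x| ^ p +
      (1 - S x ^ p) ^ ((p - 1) / p) * S x ^ (1 - p) *
        (p * |v x| ^ (p - 2) * v x * deriv v x)) x := by
    intro x hx
    obtain ⟨hy, hd⟩ := hS x ⟨hc.trans hx.1, hx.2⟩
    have hA : 0 < 1 - S x ^ p := by
      have := Real.rpow_lt_one hy.1.le hy.2 hp0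
      linarith
    have d1 := ((hd.rpow_const (p := p) (Or.inl hy.1.ne')).const_sub 1).rpow_const
      (p := (p - 1) / p) (Or.inl hA.ne')
    have d2 := hd.rpow_const (p := 1 - p) (Or.inl hy.1.ne')
    have d3 := (hasDerivAt_abs_rpow (v x) hp).comp x
      (hv.differentiable one_ne_zero x).hasDerivAt
    refine ((d1.mul d2).mul d3).congr_deriv ?_
    have a1 : (1 - S x ^ p) ^ ((p - 1) / p - 1) = ((1 - S x ^ p) ^ (1 / p))⁻¹ := by
      rw [← Real.rpow_neg hA.le]; congr 1; field_simp; ring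
    have a2 : (1 - S x ^ p) ^ ((p - 1) / p) = (1 - S x ^ p) * ((1 - S x ^ p) ^ (1 / p))⁻¹ := by
      rw [← a1]
      nth_rewrite 2 [← Real.rpow_one (1 - S x ^ p)]
      rw [← Real.rpow_add hA]; congr 1; ring
    have a3 : S x ^ (1 - p - 1) = (S x ^ p)⁻¹ := by
      rw [← Real.rpow_neg hy.1.le]; congr 1; ring
    have a4 : S x ^ (1 - p) = (S x ^ (p - 1))⁻¹ := by
      rw [← Real.rpow_neg hy.1.le]; congr 1; ring
    have hC : (1 - S x ^ p) ^ (1 / p) ≠ 0 := (Real.rpow_pos_of_pos hA _).ne'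
    have hB : S x ^ p ≠ 0 := (Real.rpow_pos_of_pos hy.1 _).ne'
    have hB' : S x ^ (p - 1) ≠ 0 := (Real.rpow_pos_of_pos hy.1 _).ne'
    simp only [Function.comp_apply, Pi.mul_apply]
    rw [a1, a2, a3, a4, Real.rpow_neg hy.1.le]
    generalize (1 - S x ^ p) ^ (1 / p) = C at *
    generalize S x ^ p = B at *
    generalize S x ^ (p - 1) = B' at *
    field_simp
    ring
  have key := intervalIntegral.sub_le_integral_of_hasDeriv_right_of_le hcl.le hWc
    (fun x hx => (hWd x hx).hasDerivWithinAt)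
    (φ := fun x => |deriv v x| ^ p - (p - 1) * |v x| ^ p)
    ((hc2.sub (continuous_const.mul hc1)).continuousOn.integrableOn_Icc)
    (fun x hx => picone_pointwise hp (hS x ⟨hc.trans hx.1, hx.2⟩).1)
  rw [intervalIntegral.integral_sub (hc2.intervalIntegrable _ _)
    ((hc1.intervalIntegrable _ _).const_mul _), intervalIntegral.integral_const_mul] at key
  have w1 : W c = 0 := by simp [hW, hvc, Real.zero_rpow hp0.ne']
  have w2 : W l = 0 := by
    have : (p - 1) / p ≠ 0 := div_ne_zero (by linarith) hp0.ne'
    simp [hW, hSl, Real.zero_rpow this]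
  rw [w1, w2] at key
  linarith

/-- The sharp Poincaré inequality on `(0, π_p)`. -/
theorem poincare_piP {p : ℝ} {v : ℝ → ℝ} (hp : 1 < p) (hv : ContDiff ℝ 1 v)
    (hvc : HasCompactSupport v) (hvs : tsupport v ⊆ Ioo 0 (piP p)) :
    (p - 1) * ∫ x, |v x| ^ p ≤ ∫ x, |deriv v x| ^ p := by
  have hp0 : 0 < p := by linarith
  obtain ⟨hpi, S, hSc, hS0, hSl, hS⟩ := exists_quarter_sinp hp
  set l := piP p / 2 with hl
  have hl0 : 0 < l := by positivity
  have hpl : piP p = 2 * l := by rw [hl]; ring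
  have hdv : Continuous (deriv v) := hv.continuous_deriv le_rfl
  have hc1 : Continuous fun x => |v x| ^ p := hv.continuous.abs.rpow_const fun _ => Or.inr hp0.le
  have hc2 : Continuous fun x => |deriv v x| ^ p := hdv.abs.rpow_const fun _ => Or.inr hp0.le
  obtain ⟨c, hc0, hcl, hcs⟩ : ∃ c, 0 < c ∧ c < l ∧ tsupport v ⊆ Ioo c (2 * l - c) := by
    have h := hvc.isCompact
    rcases (tsupport v).eq_empty_or_nonempty with he | hne
    · exact ⟨l / 2, by linarith, by linarith, by simp [he]⟩
    obtain ⟨m, hm, hmin⟩ := h.exists_isLeast hne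
    obtain ⟨M, hM, hmax⟩ := h.exists_isGreatest hne
    have b1 := hvs hm
    have b2 := hvs hM
    refine ⟨min (min m (2 * l - M)) l / 2, ?_, ?_, ?_⟩
    · have : 0 < min (min m (2 * l - M)) l := by
        refine lt_min (lt_min b1.1 ?_) hl0
        linarith [b2.2]
      linarith
    · have := min_le_right (min m (2 * l - M)) l
      linarith
    · intro x hx
      have c1 := hmin hx
      have c2 := hmax hx
      have d1 := (min_le_left (min m (2 * l - M)) l).trans (min_le_left _ _)
      have d2 := (min_le_left (min m (2 * l - M)) l).trans (min_le_right _ _)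
      constructor <;> linarith [b1.1, b2.2]
  have hz : ∀ x, x ∉ Ioo c (2 * l - c) → v x = 0 := fun x hx =>
    image_eq_zero_of_notMem_tsupport fun h => hx (hcs h)
  have hz' : ∀ x, x ∉ Ioo c (2 * l - c) → deriv v x = 0 := fun x hx =>
    image_eq_zero_of_notMem_tsupport fun h => hx (hcs (tsupport_deriv_subset h))
  have hI : ∀ w : ℝ → ℝ, Continuous w → (∀ x, x ∉ Ioo c (2 * l - c) → w x = 0) →
      ∫ x, |w x| ^ p = (∫ x in c..l, |w x| ^ p) + ∫ x in c..l, |w (2 * l - x)| ^ p := by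
    intro w hw hw0
    have hcw : Continuous fun x => |w x| ^ p := hw.abs.rpow_const fun _ => Or.inr hp0.le
    have := intervalIntegral.integral_comp_sub_left (fun x => |w x| ^ p) (2 * l) (a := c) (b := l)
    rw [this, show 2 * l - l = l by ring, intervalIntegral.integral_add_adjacent_intervals
      (hcw.intervalIntegrable _ _) (hcw.intervalIntegrable _ _)]
    symm
    apply intervalIntegral.integral_eq_integral_of_support_subset
    intro x hx
    by_contra hcon
    apply hx
    simp [hw0 x fun h => hcon (Ioo_subset_Ioc_self h), Real.zero_rpow hp0.ne']
  rw [hI v hv.continuous hz, hI _ hdv hz', mul_add]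
  have h1 := poincare_half hp hSc hSl hS hv hc0 hcl (hz c (by simp))
  have h2 := poincare_half (v := fun x => v (2 * l - x)) hp hSc hSl hS (by fun_prop) hc0 hcl
    (hz _ (by simp))
  simp only [deriv_comp_const_sub, abs_neg] at h2
  exact add_le_add h1 h2

theorem poincare_Ioo {p a b : ℝ} {v : ℝ → ℝ} (hp : 1 < p) (hab : a < b) (hv : ContDiff ℝ 1 v)
    (hvc : HasCompactSupport v) (hvs : tsupport v ⊆ Ioo a b) :
    piP p ^ p * (p - 1) * (b - a) ^ (-p) * ∫ x, |v x| ^ p ≤ ∫ x, |deriv v x| ^ p := by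
  have hp0 : 0 < p := by linarith
  have hpi := (exists_quarter_sinp hp).1
  have hba : 0 < b - a := sub_pos.mpr hab
  set μ := (b - a) / piP p with hμ
  have hμ0 : 0 < μ := by positivity
  set e : ℝ ≃ₜ ℝ := (Homeomorph.mulLeft₀ μ hμ0.ne').trans (Homeomorph.addLeft a) with he
  have hex : ∀ x, e x = a + μ * x := fun x => rfl
  have h := poincare_piP (v := fun x => v (a + μ * x)) hp (by fun_prop)
    (hvc.comp_homeomorph e) (by
      have : tsupport (v ∘ e) = e ⁻¹' tsupport v := tsupport_comp_eq_preimage v e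
      change tsupport (v ∘ e) ⊆ _
      rw [this]
      intro x hx
      have hx' := hvs hx
      rw [hex] at hx'
      have e1 : b = a + μ * piP p := by rw [hμ]; field_simp; ring
      constructor
      · have : 0 < μ * x := by linarith [hx'.1]
        exact (mul_pos_iff_of_pos_left hμ0).mp this
      · have : μ * x < μ * piP p := by linarith [hx'.2]
        exact lt_of_mul_lt_mul_left this hμ0.le)
  have hd : ∀ x, deriv (fun x => v (a + μ * x)) x = μ * deriv v (a + μ * x) := by
    intro x
    have h1 := (hv.differentiable one_ne_zero (a + μ * x)).hasDerivAt
    have h2 : HasDerivAt (fun x => a + μ * x) μ x := by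
      simpa using ((hasDerivAt_id x).const_mul μ).const_add a
    rw [mul_comm]
    exact (h1.comp x h2).deriv
  have hI : ∀ w : ℝ → ℝ, ∫ x, |w (a + μ * x)| ^ p = μ⁻¹ * ∫ x, |w x| ^ p := by
    intro w
    have := Measure.integral_comp_mul_left (fun y => |w (a + y)| ^ p) μ
    rw [this, integral_add_left_eq_self (fun y => |w y| ^ p) a, abs_of_pos (inv_pos.mpr hμ0),
      smul_eq_mul]
  simp only [hd, abs_mul, abs_of_pos hμ0, Real.mul_rpow hμ0.le (abs_nonneg _), integral_const_mul,
    hI] at h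
  have e1 : piP p ^ p * (b - a) ^ (-p) = (μ ^ p)⁻¹ := by
    rw [hμ, Real.div_rpow hba.le hpi.le, Real.rpow_neg hba.le]
    field_simp
  have hμp := Real.rpow_pos_of_pos hμ0 p
  rw [show piP p ^ p * (p - 1) * (b - a) ^ (-p) = (p - 1) * (piP p ^ p * (b - a) ^ (-p)) by ring, e1]
  have : (p - 1) * ∫ x, |v x| ^ p ≤ μ ^ p * ∫ x, |deriv v x| ^ p := by
    refine le_of_mul_le_mul_left ?_ (inv_pos.mpr hμ0)
    linarith
  rw [mul_right_comm, ← div_eq_mul_inv, div_le_iff₀ hμp]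
  linarith

theorem exists_smooth_approx {l : ℝ} {C : ℝ → ℝ} (hl : 0 < l) (hC : Continuous C)
    (hC1 : ∀ x ∈ Icc 0 l, |C x| ≤ 1) :
    ∃ χ : ℕ → ℝ → ℝ, (∀ k, ContDiff ℝ (⊤ : ℕ∞) (χ k)) ∧
      (∀ k, ∃ c, 0 < c ∧ c < l ∧ ∀ x, x ∉ Icc c (l - c) → χ k x = 0) ∧
      (∀ k x, |χ k x| ≤ 2) ∧ ∀ x ∈ Ioo 0 l, Tendsto (fun k => χ k x) atTop (𝓝 (C x)) := by
  have hr : ∀ k : ℕ, 0 < 1 / ((k : ℝ) + 1) := fun k => by positivity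
  have hr1 : ∀ k : ℕ, 1 / ((k : ℝ) + 1) ≤ 1 := fun k => by
    rw [div_le_one (by positivity)]
    have : (0 : ℝ) ≤ k := k.cast_nonneg
    linarith
  have hlim : Tendsto (fun k : ℕ => 1 / ((k : ℝ) + 1)) atTop (𝓝 0) :=
    tendsto_one_div_add_atTop_nhds_zero_nat
  choose P hP using fun k : ℕ => exists_polynomial_near_of_continuousOn 0 l C hC.continuousOn
    (1 / ((k : ℝ) + 1)) (hr k)
  let β : ∀ k : ℕ, ContDiffBump (l / 2) := fun k =>
    { rIn := l / 2 * (1 - 1 / 2 * (1 / ((k : ℝ) + 1)))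
      rOut := l / 2 * (1 - 1 / 4 * (1 / ((k : ℝ) + 1)))
      rIn_pos := by
        have := hr1 k
        exact mul_pos (by linarith) (by linarith)
      rIn_lt_rOut := by
        have := hr k
        exact mul_lt_mul_of_pos_left (by linarith) (by linarith) }
  have hz : ∀ (k : ℕ) (x : ℝ), x ∉ Icc (l / 8 * (1 / ((k : ℝ) + 1))) (l - l / 8 * (1 / ((k : ℝ) + 1))) →
      β k x * (P k).eval x = 0 := by
    intro k x hx
    rw [(β k).zero_of_le_dist, zero_mul]
    by_contra! h
    apply hx
    rw [Real.dist_eq, abs_lt] at h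
    change -(l / 2 * (1 - 1 / 4 * (1 / ((k : ℝ) + 1)))) < _ ∧
      _ < l / 2 * (1 - 1 / 4 * (1 / ((k : ℝ) + 1))) at h
    constructor <;> linarith [h.1, h.2]
  refine ⟨fun k x => β k x * (P k).eval x, ?_, ?_, ?_, ?_⟩
  · intro k
    exact (β k).contDiff.mul (by simpa using (P k).contDiff_aeval (𝕜 := ℝ) (⊤ : ℕ∞))
  · intro k
    refine ⟨l / 8 * (1 / ((k : ℝ) + 1)), mul_pos (by linarith) (hr k), ?_, hz k⟩
    have := mul_le_mul_of_nonneg_left (hr1 k) (show (0 : ℝ) ≤ l / 8 by linarith)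
    linarith
  · intro k x
    by_cases hx : x ∈ Icc 0 l
    · have h1 := hP k x hx
      have h2 := hC1 x hx
      have h3 : |(P k).eval x| ≤ 2 := by
        have := abs_sub_abs_le_abs_sub ((P k).eval x) (C x)
        linarith [hr1 k]
      rw [abs_mul, abs_of_nonneg (β k).nonneg]
      calc β k x * |(P k).eval x| ≤ 1 * |(P k).eval x| := by gcongr; exact (β k).le_one
        _ ≤ 2 := by linarith
    · change |β k x * (P k).eval x| ≤ 2
      rw [hz k x]
      · simp
      · intro h
        have := mul_pos (show (0 : ℝ) < l / 8 by linarith) (hr k)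
        exact hx ⟨by linarith [h.1], by linarith [h.2]⟩
  · intro x hx
    have h1 : ∀ᶠ k : ℕ in atTop, |x - l / 2| < l / 2 * (1 - 1 / 2 * (1 / ((k : ℝ) + 1))) := by
      have : Tendsto (fun k : ℕ => l / 2 * (1 - 1 / 2 * (1 / ((k : ℝ) + 1)))) atTop
          (𝓝 (l / 2 * (1 - 1 / 2 * 0))) := ((hlim.const_mul _).const_sub _).const_mul _
      refine this.eventually_const_lt ?_
      rw [abs_lt]
      constructor <;> linarith [hx.1, hx.2]
    have h2 : Tendsto (fun k => (P k).eval x) atTop (𝓝 (C x)) := by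
      rw [tendsto_iff_dist_tendsto_zero]
      refine squeeze_zero (fun _ => dist_nonneg) (fun k => ?_) hlim
      rw [Real.dist_eq]
      exact (hP k x (Ioo_subset_Icc_self hx)).le
    refine h2.congr' ?_
    filter_upwards [h1] with k hk
    rw [(β k).one_of_mem_closedBall, one_mul]
    rw [Metric.mem_closedBall, Real.dist_eq]
    exact hk.le

/-- The symmetric primitive of a smooth function supported in the left half of `(0, 2l)`. -/
theorem exists_symmetric_primitive {l c : ℝ} {χ : ℝ → ℝ} (hc : 0 < c) (hcl : c < l)
    (hχ : ContDiff ℝ (⊤ : ℕ∞) χ) (hz : ∀ x, x ∉ Icc c (l - c) → χ x = 0) :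
    ∃ v : ℝ → ℝ, ContDiff ℝ (⊤ : ℕ∞) v ∧ (∀ x, x ∉ Icc c (2 * l - c) → v x = 0) ∧
      (∀ x, v (2 * l - x) = v x) ∧ (∀ x, |deriv v (2 * l - x)| = |deriv v x|) ∧
      ∀ x ∈ Icc 0 l, v x = (∫ t in (0 : ℝ)..x, χ t) ∧ deriv v x = χ x := by
  set g : ℝ → ℝ := fun t => χ t - χ (2 * l - t) with hg
  have hgs : ContDiff ℝ (⊤ : ℕ∞) g := by fun_prop
  have hgi : ∀ x y, IntervalIntegrable g volume x y := fun x y =>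
    hgs.continuous.intervalIntegrable _ _
  have hodd : ∀ t, g (2 * l - t) = -g t := by intro t; simp [hg]
  set v : ℝ → ℝ := fun x => ∫ t in (0 : ℝ)..x, g t with hv
  have hd : ∀ x, HasDerivAt v (g x) x := fun x =>
    hgs.continuous.integral_hasStrictDerivAt 0 x |>.hasDerivAt
  have hdv : deriv v = g := funext fun x => (hd x).deriv
  have hsym0 : ∀ x, v (2 * l - x) = v x - v (2 * l) := by
    intro x
    have h1 := intervalIntegral.integral_comp_sub_left g (2 * l) (a := x) (b := 2 * l)
    simp only [hodd, intervalIntegral.integral_neg, sub_self] at h1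
    have h2 : v (2 * l) - v x = ∫ t in x..(2 * l), g t :=
      intervalIntegral.integral_interval_sub_left (hgi _ _) (hgi _ _)
    have h3 : v (2 * l - x) = ∫ t in (0 : ℝ)..(2 * l - x), g t := rfl
    linarith
  have hv0 : v 0 = 0 := by simp [hv]
  have hsym : ∀ x, v (2 * l - x) = v x := by
    have h1 := hsym0 0
    rw [sub_zero, hv0] at h1
    intro x
    rw [hsym0 x]; linarith
  have hleft : ∀ x < c, v x = 0 := by
    intro x hx
    have : ∀ t ∈ uIcc 0 x, g t = 0 := by
      intro t ht
      have ht' : t < c := lt_of_le_of_lt ht.2 (max_lt hc hx)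
      simp only [hg]
      rw [hz t fun h => by linarith [h.1], hz _ fun h => by linarith [h.2], sub_zero]
    simp only [hv]
    rw [intervalIntegral.integral_congr (g := fun _ => (0 : ℝ)) this]
    simp
  refine ⟨v, ?_, ?_, hsym, ?_, ?_⟩
  · rw [contDiff_infty_iff_deriv]
    exact ⟨fun x => (hd x).differentiableAt, hdv ▸ hgs⟩
  · intro x hx
    by_cases h : x < c
    · exact hleft x h
    · rw [← hsym]
      apply hleft
      by_contra h'
      exact hx ⟨by linarith, by linarith⟩
  · intro x
    rw [hdv, hodd, abs_neg]
  · intro x hx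
    have h0 : ∀ t ≤ l, g t = χ t := by
      intro t ht
      simp only [hg]
      rw [hz (2 * l - t) fun h => by linarith [h.2], sub_zero]
    refine ⟨?_, by rw [hdv, h0 x hx.2]⟩
    apply intervalIntegral.integral_congr
    intro t ht
    rw [uIcc_of_le hx.1] at ht
    exact h0 t (ht.2.trans hx.2)

theorem integral_abs_rpow_eq_two_mul {p l c : ℝ} {w : ℝ → ℝ} (hp : 0 < p) (hw : Continuous w)
    (hc : 0 < c) (hz : ∀ x, x ∉ Icc c (2 * l - c) → w x = 0)
    (hsym : ∀ x, |w (2 * l - x)| = |w x|) :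
    ∫ x, |w x| ^ p = 2 * ∫ x in (0 : ℝ)..l, |w x| ^ p := by
  have hcw : Continuous fun x => |w x| ^ p := hw.abs.rpow_const fun _ => Or.inr hp.le
  have h1 := intervalIntegral.integral_comp_sub_left (fun x => |w x| ^ p) (2 * l) (a := 0) (b := l)
  simp only [hsym, sub_zero] at h1
  rw [two_mul]
  nth_rewrite 2 [h1]
  rw [show 2 * l - l = l by ring, intervalIntegral.integral_add_adjacent_intervals
    (hcw.intervalIntegrable _ _) (hcw.intervalIntegrable _ _)]
  symm
  apply intervalIntegral.integral_eq_integral_of_support_subset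
  intro x hx
  by_contra hcon
  apply hx
  have : x ∉ Icc c (2 * l - c) := fun h => hcon ⟨by linarith [h.1], by linarith [h.2]⟩
  simp [hz x this, Real.zero_rpow hp.ne']

/-- `sin_p` on its quarter period has `p`-energy `p - 1` times its `p`-mass. -/
theorem energy_quarter_sinp {p l : ℝ} {S : ℝ → ℝ} (hp : 1 < p) (hl : 0 < l) (hSc : Continuous S)
    (hS0 : S 0 = 0) (hSl : S l = 1)
    (hS : ∀ x ∈ Ioo 0 l, S x ∈ Ioo 0 1 ∧ HasDerivAt S ((1 - S x ^ p) ^ (1 / p)) x) :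
    ∫ x in (0 : ℝ)..l, |(1 - S x ^ p) ^ (1 / p)| ^ p =
      (p - 1) * ∫ x in (0 : ℝ)..l, |S x| ^ p := by
  have hp0 : 0 < p := by linarith
  have hSp : Continuous fun x => S x ^ p := hSc.rpow_const fun _ => Or.inr hp0.le
  have hC : Continuous fun x => (1 - S x ^ p) ^ (1 / p) :=
    (continuous_const.sub hSp).rpow_const fun _ => Or.inr (by positivity)
  have hc1 : Continuous fun x => |S x| ^ p := hSc.abs.rpow_const fun _ => Or.inr hp0.le
  have hc2 : Continuous fun x => |(1 - S x ^ p) ^ (1 / p)| ^ p :=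
    hC.abs.rpow_const fun _ => Or.inr hp0.le
  have hH : Continuous fun x => S x * (1 - S x ^ p) ^ ((p - 1) / p) :=
    hSc.mul ((continuous_const.sub hSp).rpow_const fun _ =>
      Or.inr (div_nonneg (by linarith) hp0.le))
  have hd : ∀ x ∈ Ioo 0 l, HasDerivAt (fun x => S x * (1 - S x ^ p) ^ ((p - 1) / p))
      (|(1 - S x ^ p) ^ (1 / p)| ^ p - (p - 1) * |S x| ^ p) x := by
    intro x hx
    obtain ⟨hy, hd⟩ := hS x hx
    have hA : 0 < 1 - S x ^ p := by
      have := Real.rpow_lt_one hy.1.le hy.2 hp0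
      linarith
    have d1 := ((hd.rpow_const (p := p) (Or.inl hy.1.ne')).const_sub 1).rpow_const
      (p := (p - 1) / p) (Or.inl hA.ne')
    refine (hd.mul d1).congr_deriv ?_
    have a1 : (1 - S x ^ p) ^ ((p - 1) / p - 1) = ((1 - S x ^ p) ^ (1 / p))⁻¹ := by
      rw [← Real.rpow_neg hA.le]; congr 1; field_simp; ring
    have a2 : (1 - S x ^ p) ^ ((p - 1) / p) = (1 - S x ^ p) * ((1 - S x ^ p) ^ (1 / p))⁻¹ := by
      rw [← a1]
      nth_rewrite 2 [← Real.rpow_one (1 - S x ^ p)]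
      rw [← Real.rpow_add hA]; congr 1; ring
    have a3 : S x ^ (p - 1) = S x ^ p / S x := Real.rpow_sub_one hy.1.ne' p
    have a4 : |(1 - S x ^ p) ^ (1 / p)| ^ p = 1 - S x ^ p := by
      rw [abs_of_nonneg (Real.rpow_nonneg hA.le _), ← Real.rpow_mul hA.le]
      rw [one_div_mul_cancel hp0.ne', Real.rpow_one]
    have hC : (1 - S x ^ p) ^ (1 / p) ≠ 0 := (Real.rpow_pos_of_pos hA _).ne'
    rw [a4, a1, a2, a3, abs_of_pos hy.1]
    generalize (1 - S x ^ p) ^ (1 / p) = C at *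
    have := hy.1.ne'
    field_simp
    ring
  have h := intervalIntegral.integral_eq_sub_of_hasDerivAt_of_le hl.le hH.continuousOn hd
    ((hc2.intervalIntegrable _ _).sub ((hc1.intervalIntegrable _ _).const_mul _))
  rw [intervalIntegral.integral_sub (hc2.intervalIntegrable _ _)
    ((hc1.intervalIntegrable _ _).const_mul _), intervalIntegral.integral_const_mul] at h
  have : (p - 1) / p ≠ 0 := div_ne_zero (by linarith) hp0.ne'
  simp only [hS0, hSl, Real.one_rpow, sub_self, Real.zero_rpow this, mul_zero, zero_mul] at h
  linarith

theorem exists_almost_extremal_piP {p ε : ℝ} (hp : 1 < p) (hε : 0 < ε) :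
    ∃ v : ℝ → ℝ, ContDiff ℝ (⊤ : ℕ∞) v ∧ HasCompactSupport v ∧ tsupport v ⊆ Ioo 0 (piP p) ∧
      0 < ∫ x, |v x| ^ p ∧ ∫ x, |deriv v x| ^ p ≤ (p - 1 + ε) * ∫ x, |v x| ^ p := by
  have hp0 : 0 < p := by linarith
  obtain ⟨hpi, S, hSc, hS0, hSl, hS⟩ := exists_quarter_sinp hp
  set l := piP p / 2 with hl
  have hl0 : 0 < l := by positivity
  have hpl : piP p = 2 * l := by rw [hl]; ring
  set C : ℝ → ℝ := fun x => (1 - S x ^ p) ^ (1 / p) with hCdef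
  have hSp : Continuous fun x => S x ^ p := hSc.rpow_const fun _ => Or.inr hp0.le
  have hC : Continuous C :=
    (continuous_const.sub hSp).rpow_const fun _ => Or.inr (by positivity)
  have hSI : ∀ x ∈ Icc 0 l, S x ∈ Icc 0 1 := by
    intro x hx
    rcases eq_or_lt_of_le hx.1 with rfl | h1
    · simp [hS0]
    rcases eq_or_lt_of_le hx.2 with rfl | h2
    · simp [hSl]
    exact Ioo_subset_Icc_self (hS x ⟨h1, h2⟩).1
  have hC1 : ∀ x ∈ Icc 0 l, |C x| ≤ 1 := by
    intro x hx
    have h := hSI x hx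
    have h1 := Real.rpow_nonneg h.1 p
    have h2 := Real.rpow_le_one h.1 h.2 hp0.le
    rw [abs_of_nonneg (Real.rpow_nonneg (by linarith) _)]
    exact Real.rpow_le_one (by linarith) (by linarith) (by positivity)
  obtain ⟨χ, hχs, hχc, hχb, hχt⟩ := exists_smooth_approx hl0 hC hC1
  choose c hc hcl hχz using hχc
  choose v hvs hvz hvsym hvsym' hv using fun k =>
    exists_symmetric_primitive (hc k) (hcl k) (hχs k) (hχz k)
  have hvc : ∀ k, Continuous (v k) := fun k => (hvs k).continuous
  have hvd : ∀ k, Continuous (deriv (v k)) := fun k =>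
    (hvs k).continuous_deriv (by exact_mod_cast le_top)
  have hpow : ∀ w : ℝ → ℝ, Continuous w → Continuous fun x => |w x| ^ p := fun w hw =>
    hw.abs.rpow_const fun _ => Or.inr hp0.le
  have hts : ∀ k, tsupport (v k) ⊆ Icc (c k) (2 * l - c k) := fun k =>
    closure_minimal (fun x hx => by
      by_contra h
      exact hx (hvz k x h)) isClosed_Icc
  have hprim : ∀ x ∈ Icc 0 l, ∫ t in (0 : ℝ)..x, C t = S x := by
    intro x hx
    rw [intervalIntegral.integral_eq_sub_of_hasDerivAt_of_le hx.1 hSc.continuousOn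
      (fun t ht => (hS t ⟨ht.1, ht.2.trans_le hx.2⟩).2) (hC.intervalIntegrable _ _), hS0, sub_zero]
  have hne : ∀ᵐ x : ℝ, x ≠ l := by simp [ae_iff, measure_singleton]
  have limN : Tendsto (fun k => ∫ x in (0 : ℝ)..l, |deriv (v k) x| ^ p) atTop
      (𝓝 (∫ x in (0 : ℝ)..l, |C x| ^ p)) := by
    refine intervalIntegral.tendsto_integral_filter_of_dominated_convergence (fun _ => 2 ^ p)
      (Eventually.of_forall fun k => (hpow _ (hvd k)).aestronglyMeasurable)
      (Eventually.of_forall fun k => Eventually.of_forall fun x hx => ?_)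
      intervalIntegrable_const ?_
    · rw [uIoc_of_le hl0.le] at hx
      rw [(hv k x (Ioc_subset_Icc_self hx)).2, Real.norm_of_nonneg (by positivity)]
      exact Real.rpow_le_rpow (abs_nonneg _) (hχb k x) hp0.le
    · filter_upwards [hne] with x hxl hx
      rw [uIoc_of_le hl0.le] at hx
      simp only [fun k => (hv k x (Ioc_subset_Icc_self hx)).2]
      exact (hχt x ⟨hx.1, lt_of_le_of_ne hx.2 hxl⟩).abs.rpow_const (Or.inr hp0.le)
  have limD : Tendsto (fun k => ∫ x in (0 : ℝ)..l, |v k x| ^ p) atTop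
      (𝓝 (∫ x in (0 : ℝ)..l, |S x| ^ p)) := by
    refine intervalIntegral.tendsto_integral_filter_of_dominated_convergence
      (fun _ => (2 * l) ^ p)
      (Eventually.of_forall fun k => (hpow _ (hvc k)).aestronglyMeasurable)
      (Eventually.of_forall fun k => Eventually.of_forall fun x hx => ?_)
      intervalIntegrable_const (Eventually.of_forall fun x hx => ?_)
    · rw [uIoc_of_le hl0.le] at hx
      rw [(hv k x (Ioc_subset_Icc_self hx)).1, Real.norm_of_nonneg (by positivity)]
      refine Real.rpow_le_rpow (abs_nonneg _) ?_ hp0.le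
      have := intervalIntegral.norm_integral_le_of_norm_le_const (a := 0) (b := x) (C := 2)
        (f := χ k) fun t _ => hχb k t
      rw [Real.norm_eq_abs, sub_zero, abs_of_pos hx.1] at this
      linarith [hx.2]
    · rw [uIoc_of_le hl0.le] at hx
      have hx' := Ioc_subset_Icc_self hx
      simp only [fun k => (hv k x hx').1]
      rw [← hprim x hx']
      refine Tendsto.rpow_const (Tendsto.abs ?_) (Or.inr hp0.le)
      refine intervalIntegral.tendsto_integral_filter_of_dominated_convergence (fun _ => 2)
        (Eventually.of_forall fun k => (hχs k).continuous.aestronglyMeasurable)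
        (Eventually.of_forall fun k => Eventually.of_forall fun t _ => hχb k t)
        intervalIntegrable_const ?_
      filter_upwards [hne] with t htl ht
      rw [uIoc_of_le hx'.1] at ht
      exact hχt t ⟨ht.1, lt_of_le_of_ne (ht.2.trans hx.2) htl⟩
  rw [energy_quarter_sinp hp hl0 hSc hS0 hSl hS] at limN
  set I := ∫ x in (0 : ℝ)..l, |S x| ^ p with hI
  have hI0 : 0 < I := by
    refine intervalIntegral.intervalIntegral_pos_of_pos_on
      ((hpow S hSc).intervalIntegrable _ _) (fun x hx => ?_) hl0
    exact Real.rpow_pos_of_pos (abs_pos.mpr (hS x hx).1.1.ne') _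
  have ev1 := limD.eventually_const_lt hI0
  have ev2 := (limN.sub (limD.const_mul (p - 1 + ε))).eventually_lt_const (u := 0) (by
    nlinarith [mul_pos hε hI0])
  obtain ⟨k, hk1, hk2⟩ := (ev1.and ev2).exists
  have e1 := integral_abs_rpow_eq_two_mul hp0 (hvc k) (hc k) (hvz k)
    (fun x => by rw [hvsym k x])
  have hvz' : ∀ x, x ∉ Icc (c k) (2 * l - c k) → deriv (v k) x = 0 := fun x hx =>
    image_eq_zero_of_notMem_tsupport fun h => hx (hts k (tsupport_deriv_subset h))
  have e2 := integral_abs_rpow_eq_two_mul hp0 (hvd k) (hc k) hvz' (hvsym' k)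
  refine ⟨v k, hvs k, isCompact_Icc.of_isClosed_subset (isClosed_tsupport _) (hts k), ?_, ?_, ?_⟩
  · intro x hx
    have := hts k hx
    rw [hpl]
    exact ⟨by linarith [this.1, hc k], by linarith [this.2, hc k]⟩
  · rw [e1]; linarith
  · rw [e1, e2]; linarith

theorem exists_almost_extremal_Ioo {p a b ε : ℝ} (hp : 1 < p) (hab : a < b) (hε : 0 < ε) :
    ∃ v : ℝ → ℝ, ContDiff ℝ (⊤ : ℕ∞) v ∧ HasCompactSupport v ∧ tsupport v ⊆ Ioo a b ∧
      0 < ∫ x, |v x| ^ p ∧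
      ∫ x, |deriv v x| ^ p ≤ (piP p ^ p * (p - 1) * (b - a) ^ (-p) + ε) * ∫ x, |v x| ^ p := by
  have hp0 : 0 < p := by linarith
  have hpi := (exists_quarter_sinp hp).1
  have hba : 0 < b - a := sub_pos.mpr hab
  set μ := piP p / (b - a) with hμ
  have hμ0 : 0 < μ := by positivity
  have hμp := Real.rpow_pos_of_pos hμ0 p
  obtain ⟨v, hv, hvc, hvs, hvpos, hvle⟩ :=
    exists_almost_extremal_piP hp (ε := ε / μ ^ p) (by positivity)
  set e : ℝ ≃ₜ ℝ := (Homeomorph.subRight a).trans (Homeomorph.mulLeft₀ μ hμ0.ne') with he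
  have hex : ∀ x, e x = μ * (x - a) := fun x => rfl
  have hd : ∀ x, deriv (fun x => v (μ * (x - a))) x = μ * deriv v (μ * (x - a)) := by
    intro x
    have h1 := (hv.differentiable (by simp) (μ * (x - a))).hasDerivAt
    have h2 : HasDerivAt (fun x => μ * (x - a)) μ x := by
      simpa using ((hasDerivAt_id x).sub_const a).const_mul μ
    rw [mul_comm]
    exact (h1.comp x h2).deriv
  have hI : ∀ w : ℝ → ℝ, ∫ x, |w (μ * (x - a))| ^ p = μ⁻¹ * ∫ x, |w x| ^ p := by
    intro w
    rw [integral_sub_right_eq_self (fun y => |w (μ * y)| ^ p) a,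
      Measure.integral_comp_mul_left (fun y => |w y| ^ p) μ, abs_of_pos (inv_pos.mpr hμ0),
      smul_eq_mul]
  refine ⟨fun x => v (μ * (x - a)), by fun_prop, hvc.comp_homeomorph e, ?_, ?_, ?_⟩
  · have : tsupport (v ∘ e) = e ⁻¹' tsupport v := tsupport_comp_eq_preimage v e
    change tsupport (v ∘ e) ⊆ _
    rw [this]
    intro x hx
    have hx' := hvs hx
    rw [hex] at hx'
    have e1 : piP p = μ * (b - a) := by rw [hμ]; field_simp
    constructor
    · have := (mul_pos_iff_of_pos_left hμ0).mp hx'.1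
      linarith
    · have h2 : μ * (x - a) < μ * (b - a) := by linarith [hx'.2]
      have := lt_of_mul_lt_mul_left h2 hμ0.le
      linarith
  · rw [hI]; positivity
  · simp only [hd, abs_mul, abs_of_pos hμ0, Real.mul_rpow hμ0.le (abs_nonneg _),
      integral_const_mul, hI]
    have e1 : piP p ^ p * (b - a) ^ (-p) = μ ^ p := by
      rw [hμ, Real.div_rpow hpi.le hba.le, Real.rpow_neg hba.le]
      field_simp
    have e2 : piP p ^ p * (p - 1) * (b - a) ^ (-p) + ε = μ ^ p * (p - 1 + ε / μ ^ p) := by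
      rw [mul_right_comm, e1]; field_simp
    rw [e2]
    have := mul_le_mul_of_nonneg_left hvle (show 0 ≤ μ ^ p * μ⁻¹ by positivity)
    linarith

theorem hasDerivAt_comp_update {n : ℕ} {u : (Fin n → ℝ) → ℝ} (hu : Differentiable ℝ u) (i : Fin n)
    (x : Fin n → ℝ) (t : ℝ) :
    HasDerivAt (fun t => u (Function.update x i t)) (pder i u (Function.update x i t)) t :=
  (hu _).hasFDerivAt.comp_hasDerivAt t (hasDerivAt_update x i t)

theorem pder_add {n : ℕ} {u v : (Fin n → ℝ) → ℝ} (hu : Differentiable ℝ u)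
    (hv : Differentiable ℝ v) (i : Fin n) (x : Fin n → ℝ) :
    pder i (u + v) x = pder i u x + pder i v x := by
  simp [pder, fderiv_add (hu x) (hv x)]

theorem pder_const_smul {n : ℕ} {u : (Fin n → ℝ) → ℝ} (hu : Differentiable ℝ u) (c : ℝ)
    (i : Fin n) (x : Fin n → ℝ) : pder i (c • u) x = c * pder i u x := by
  simp [pder, fderiv_const_smul (hu x)]

namespace IsTestFun

variable {n : ℕ} {D : Set (Fin n → ℝ)} {u v : (Fin n → ℝ) → ℝ}

theorem differentiable (hu : IsTestFun D u) : Differentiable ℝ u := hu.1.differentiable (by simp)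

theorem continuous_pder (hu : IsTestFun D u) (i : Fin n) : Continuous (pder i u) :=
  (hu.1.continuous_fderiv (by simp)).clm_apply continuous_const

theorem hasCompactSupport_pder (hu : IsTestFun D u) (i : Fin n) : HasCompactSupport (pder i u) :=
  hu.2.1.fderiv_apply ℝ (Pi.single i 1)

theorem add (hu : IsTestFun D u) (hv : IsTestFun D v) : IsTestFun D (u + v) :=
  ⟨hu.1.add hv.1, hu.2.1.add hv.2.1, (tsupport_add u v).trans (union_subset hu.2.2 hv.2.2)⟩

theorem const_smul (hu : IsTestFun D u) (c : ℝ) : IsTestFun D (c • u) := by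
  have h : tsupport (c • u) ⊆ tsupport u := closure_mono fun x hx h0 => hx (by simp [h0])
  exact ⟨contDiff_const.smul hu.1, hu.2.1.isCompact.of_isClosed_subset (isClosed_tsupport _) h,
    h.trans hu.2.2⟩

theorem zero : IsTestFun D (0 : (Fin n → ℝ) → ℝ) :=
  ⟨contDiff_const, HasCompactSupport.zero, by simp [tsupport]⟩

theorem continuous_jet (hu : IsTestFun D u) (q : ℝ≥0∞) : Continuous (jet q u) := by
  refine (PiLp.continuous_toLp q _).comp (continuous_pi fun j => ?_)
  refine Fin.cases ?_ (fun i => ?_) j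
  · exact hu.1.continuous
  · exact hu.continuous_pder i

theorem hasCompactSupport_jet (hu : IsTestFun D u) (q : ℝ≥0∞) : HasCompactSupport (jet q u) := by
  refine hu.2.1.isCompact.of_isClosed_subset (isClosed_tsupport _)
    (closure_minimal (fun x hx => ?_) (isClosed_tsupport _))
  by_contra h
  apply hx
  have h1 : fderiv ℝ u x = 0 := image_eq_zero_of_notMem_tsupport fun h' =>
    h (tsupport_fderiv_subset ℝ h')
  ext j
  refine Fin.cases ?_ (fun i => ?_) j
  · exact (image_eq_zero_of_notMem_tsupport h : u x = 0)
  · simp [jet, pder, h1]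

theorem memLp_jet (hu : IsTestFun D u) (q : ℝ≥0∞) [Fact (1 ≤ q)] : MemLp (jet q u) q volume :=
  (hu.continuous_jet q).memLp_of_hasCompactSupport (hu.hasCompactSupport_jet q)

theorem integrable_abs_rpow {w : (Fin n → ℝ) → ℝ} {p : ℝ} (hp : 0 < p) (hw : Continuous w)
    (hc : HasCompactSupport w) : Integrable (fun x => |w x| ^ p) :=
  (hw.abs.rpow_const fun _ => Or.inr hp.le).integrable_of_hasCompactSupport
    (hc.comp_left (g := fun t => |t| ^ p) (by simp [Real.zero_rpow hp.ne']))

end IsTestFun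

theorem jet_add {n : ℕ} {u v : (Fin n → ℝ) → ℝ} (q : ℝ≥0∞) (hu : Differentiable ℝ u)
    (hv : Differentiable ℝ v) : jet q (u + v) = jet q u + jet q v := by
  ext x j
  refine Fin.cases ?_ (fun i => ?_) j
  · rfl
  · exact pder_add hu hv i x

theorem jet_const_smul {n : ℕ} {u : (Fin n → ℝ) → ℝ} (q : ℝ≥0∞) (hu : Differentiable ℝ u)
    (c : ℝ) : jet q (c • u) = c • jet q u := by
  ext x j
  refine Fin.cases ?_ (fun i => ?_) j
  · rfl
  · exact pder_const_smul hu c i x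

theorem jet_zero {n : ℕ} (q : ℝ≥0∞) : jet q (0 : (Fin n → ℝ) → ℝ) = 0 := by
  ext x j
  refine Fin.cases ?_ (fun i => ?_) j
  · rfl
  · simp [jet, pder]

theorem exists_jet_of_mem_span {n : ℕ} {D : Set (Fin n → ℝ)} {q : ℝ≥0∞} [Fact (1 ≤ q)]
    {f : Vsp n q} (hf : f ∈ Submodule.span ℝ {f : Vsp n q | ∃ u : (Fin n → ℝ) → ℝ, IsTestFun D u ∧
      (f : (Fin n → ℝ) → PiLp q (fun _ : Fin (n + 1) => ℝ)) =ᵐ[volume] jet q u}) :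
    ∃ u : (Fin n → ℝ) → ℝ, IsTestFun D u ∧
      (f : (Fin n → ℝ) → PiLp q (fun _ : Fin (n + 1) => ℝ)) =ᵐ[volume] jet q u := by
  induction hf using Submodule.span_induction with
  | mem f h => exact h
  | zero => exact ⟨0, IsTestFun.zero, by rw [jet_zero]; exact Lp.coeFn_zero _ _ _⟩
  | add f g _ _ hf hg =>
    obtain ⟨u, hu, hfu⟩ := hf
    obtain ⟨v, hv, hgv⟩ := hg
    refine ⟨u + v, hu.add hv, ?_⟩
    rw [jet_add q hu.differentiable hv.differentiable]
    exact (Lp.coeFn_add f g).trans (hfu.add hgv)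
  | smul c f _ hf =>
    obtain ⟨u, hu, hfu⟩ := hf
    refine ⟨c • u, hu.const_smul c, ?_⟩
    rw [jet_const_smul q hu.differentiable]
    exact (Lp.coeFn_smul c f).trans (hfu.const_smul c)

/-- A closed property of jets of test functions holds on all of `W^{1,p}_0`. -/
theorem W0sub_induction {n : ℕ} {D : Set (Fin n → ℝ)} {q : ℝ≥0∞} [Fact (1 ≤ q)]
    {P : Vsp n q → Prop} (hP : IsClosed {f | P f})
    (hjet : ∀ (f : Vsp n q) (u : (Fin n → ℝ) → ℝ), IsTestFun D u →
      (f : (Fin n → ℝ) → PiLp q (fun _ : Fin (n + 1) => ℝ)) =ᵐ[volume] jet q u → P f)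
    (f : W0sub q D) : P f := by
  have h : closure _ ⊆ {f | P f} := closure_minimal (fun g hg => by
    obtain ⟨u, hu, hgu⟩ := exists_jet_of_mem_span (D := D) hg
    exact hjet g u hu hgu) hP
  exact h f.2

theorem Lp_norm_rpow {α F : Type*} [MeasurableSpace α] {μ : Measure α} [NormedAddCommGroup F]
    {p : ℝ} (hp : 1 < p) (f : Lp F (ENNReal.ofReal p) μ) :
    ‖f‖ ^ p = ∫ x, ‖f x‖ ^ p ∂μ := by
  have hp0 : 0 < p := by linarith
  have h0 : 0 ≤ ∫ x, ‖f x‖ ^ p ∂μ :=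
    integral_nonneg fun x => Real.rpow_nonneg (norm_nonneg _) _
  rw [Lp.norm_def, (Lp.memLp f).eLpNorm_eq_integral_rpow_norm (by simpa using hp0)
    ENNReal.ofReal_ne_top, ENNReal.toReal_ofReal hp0.le,
    ENNReal.toReal_ofReal (Real.rpow_nonneg h0 _), ← Real.rpow_mul h0,
    inv_mul_cancel₀ hp0.ne', Real.rpow_one]

section

variable {n : ℕ} {p : ℝ} [Fact (1 ≤ ENNReal.ofReal p)]

theorem norm_proj0_rpow (hp : 1 < p) (f : Vsp n (ENNReal.ofReal p)) :
    ‖(proj0 n (ENNReal.ofReal p)).compLpL (ENNReal.ofReal p) volume f‖ ^ p =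
      ∫ x, |f x 0| ^ p := by
  rw [Lp_norm_rpow hp]
  apply integral_congr_ae
  filter_upwards [ContinuousLinearMap.coeFn_compLpL (𝕜' := ℝ) (proj0 n (ENNReal.ofReal p)) f]
    with x hx
  rw [hx]
  rfl

theorem norm_projGrad_rpow (hp : 1 < p) (f : Vsp n (ENNReal.ofReal p)) :
    ‖(projGrad n (ENNReal.ofReal p)).compLpL (ENNReal.ofReal p) volume f‖ ^ p =
      ∫ x, ∑ i : Fin n, |f x i.succ| ^ p := by
  have hp0 : 0 < p := by linarith
  rw [Lp_norm_rpow hp]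
  apply integral_congr_ae
  filter_upwards [ContinuousLinearMap.coeFn_compLpL (𝕜' := ℝ) (projGrad n (ENNReal.ofReal p)) f]
    with x hx
  rw [hx, PiLp.norm_eq_sum (by rwa [ENNReal.toReal_ofReal hp0.le]), ENNReal.toReal_ofReal hp0.le,
    ← Real.rpow_mul (Finset.sum_nonneg fun i _ => Real.rpow_nonneg (norm_nonneg _) _),
    one_div_mul_cancel hp0.ne', Real.rpow_one]
  rfl

theorem norm_proj0_rpow_jet (hp : 1 < p) {f : Vsp n (ENNReal.ofReal p)} {u : (Fin n → ℝ) → ℝ}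
    (hfu : (f : (Fin n → ℝ) → PiLp (ENNReal.ofReal p) (fun _ : Fin (n + 1) => ℝ)) =ᵐ[volume]
      jet (ENNReal.ofReal p) u) :
    ‖(proj0 n (ENNReal.ofReal p)).compLpL (ENNReal.ofReal p) volume f‖ ^ p =
      ∫ x, |u x| ^ p := by
  rw [norm_proj0_rpow hp]
  apply integral_congr_ae
  filter_upwards [hfu] with x hx
  rw [hx]
  rfl

theorem norm_projGrad_rpow_jet (hp : 1 < p) {D : Set (Fin n → ℝ)}
    {f : Vsp n (ENNReal.ofReal p)} {u : (Fin n → ℝ) → ℝ} (hu : IsTestFun D u)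
    (hfu : (f : (Fin n → ℝ) → PiLp (ENNReal.ofReal p) (fun _ : Fin (n + 1) => ℝ)) =ᵐ[volume]
      jet (ENNReal.ofReal p) u) :
    ‖(projGrad n (ENNReal.ofReal p)).compLpL (ENNReal.ofReal p) volume f‖ ^ p =
      ∑ i, ∫ x, |pder i u x| ^ p := by
  rw [norm_projGrad_rpow hp, ← integral_finsetSum _ fun i _ =>
    IsTestFun.integrable_abs_rpow (by linarith) (hu.continuous_pder i) (hu.hasCompactSupport_pder i)]
  apply integral_congr_ae
  filter_upwards [hfu] with x hx
  rw [hx]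
  rfl

end

/-- The Poincaré inequality in a bounded direction of the strip, by slicing. -/
theorem poincare_coord {n k : ℕ} {p : ℝ} {a b : Fin n → ℝ} {u : (Fin n → ℝ) → ℝ} (hp : 1 < p)
    (hu : IsTestFun (stripDomain n k a b) u) {i : Fin n} (hi : k ≤ (i : ℕ)) (hab : a i < b i) :
    piP p ^ p * (p - 1) * (b i - a i) ^ (-p) * ∫ x, |u x| ^ p ≤ ∫ x, |pder i u x| ^ p := by
  have hp0 : 0 < p := by linarith
  set L := piP p ^ p * (p - 1) * (b i - a i) ^ (-p) with hL
  have hL0 : 0 ≤ L := mul_nonneg (mul_nonneg (Real.rpow_nonneg (exists_quarter_sinp hp).1.le _)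
    (by linarith)) (Real.rpow_nonneg (by linarith) _)
  have hpow : ∀ {X : Type} [TopologicalSpace X] {w : X → ℝ}, Continuous w →
      Continuous fun x => |w x| ^ p := fun hw => hw.abs.rpow_const fun _ => Or.inr hp0.le
  have i1 := IsTestFun.integrable_abs_rpow hp0 hu.1.continuous hu.2.1
  have i2 := IsTestFun.integrable_abs_rpow hp0 (hu.continuous_pder i) (hu.hasCompactSupport_pder i)
  have n1 : ∀ x, 0 ≤ L * |u x| ^ p := fun x => by positivity
  have n2 : ∀ x, 0 ≤ |pder i u x| ^ p := fun x => by positivity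
  rw [← integral_const_mul, integral_eq_lintegral_of_nonneg_ae (ae_of_all _ n1)
    (i1.const_mul L).aestronglyMeasurable, integral_eq_lintegral_of_nonneg_ae (ae_of_all _ n2)
    i2.aestronglyMeasurable]
  have fin2 : ∫⁻ x, ENNReal.ofReal (|pder i u x| ^ p) ≠ ∞ := by
    rw [← ofReal_integral_eq_lintegral_ofReal i2 (ae_of_all _ n2)]
    exact ENNReal.ofReal_ne_top
  refine ENNReal.toReal_mono fin2 ?_
  refine lintegral_le_of_lmarginal_le {i}
    (continuous_const.mul (hpow hu.1.continuous)).measurable.ennreal_ofReal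
    (hpow (hu.continuous_pder i)).measurable.ennreal_ofReal ?_
  intro x
  rw [lmarginal_singleton, lmarginal_singleton]
  set v : ℝ → ℝ := fun t => u (Function.update x i t) with hv
  have hcu : Continuous (Function.update x i) := continuous_const.update i continuous_id
  have hd : ∀ t, deriv v t = pder i u (Function.update x i t) := fun t =>
    (hasDerivAt_comp_update hu.differentiable i x t).deriv
  have hdv : deriv v = fun t => pder i u (Function.update x i t) := funext hd
  have hdc : Continuous (deriv v) := hdv ▸ (hu.continuous_pder i).comp hcu
  have hvs : ContDiff ℝ 1 v := by
    rw [contDiff_one_iff_deriv]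
    exact ⟨fun t => (hasDerivAt_comp_update hu.differentiable i x t).differentiableAt, hdc⟩
  have hts : tsupport v ⊆ Function.update x i ⁻¹' tsupport u :=
    closure_minimal (fun t ht => subset_tsupport u ht) ((isClosed_tsupport u).preimage hcu)
  have hvc : HasCompactSupport v := by
    refine (hu.2.1.isCompact.image (continuous_apply i)).of_isClosed_subset (isClosed_tsupport _) ?_
    intro t ht
    exact ⟨_, hts ht, by simp⟩
  have hvI : tsupport v ⊆ Ioo (a i) (b i) := by
    intro t ht
    simpa using hu.2.2 (hts ht) i hi
  have key := poincare_Ioo hp hab hvs hvc hvI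
  rw [← hL, ← integral_const_mul] at key
  have j1 : Integrable fun t => L * |v t| ^ p :=
    (((hpow hvs.continuous).integrable_of_hasCompactSupport
      (hvc.comp_left (g := fun t => |t| ^ p) (by simp [Real.zero_rpow hp0.ne'])))).const_mul L
  have j2 : Integrable fun t => |deriv v t| ^ p :=
    (hpow hdc).integrable_of_hasCompactSupport
      (hvc.deriv.comp_left (g := fun t => |t| ^ p) (by simp [Real.zero_rpow hp0.ne']))
  have := ENNReal.ofReal_le_ofReal key
  rw [ofReal_integral_eq_lintegral_ofReal j1 (ae_of_all _ fun t => by positivity),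
    ofReal_integral_eq_lintegral_ofReal j2 (ae_of_all _ fun t => by positivity), hdv] at this
  exact this

theorem continuous_integral_coord_mul {n : ℕ} {q : ℝ≥0∞} [hq : Fact (1 ≤ q)] (j : Fin (n + 1))
    {φ : (Fin n → ℝ) → ℝ} (hφ : Continuous φ) (hc : HasCompactSupport φ) :
    Continuous fun f : Vsp n q => ∫ x, f x j * φ x := by
  have : q.HolderConjugate q.conjExponent := ENNReal.HolderConjugate.conjExponent hq.out
  have : Fact (1 ≤ q.conjExponent) := ⟨ENNReal.HolderConjugate.one_le q.conjExponent q⟩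
  have hφL : MemLp φ q.conjExponent volume := hφ.memLp_of_hasCompactSupport hc
  let B : PiLp q (fun _ : Fin (n + 1) => ℝ) →L[ℝ] ℝ →L[ℝ] ℝ :=
    (ContinuousLinearMap.mul ℝ ℝ).comp (PiLp.proj q (fun _ : Fin (n + 1) => ℝ) j)
  have h : (fun f : Vsp n q => ∫ x, f x j * φ x) =
      fun f => B.lpPairing volume q q.conjExponent f (hφL.toLp φ) := by
    ext f
    rw [ContinuousLinearMap.lpPairing_eq_integral]
    apply integral_congr_ae
    filter_upwards [hφL.coeFn_toLp] with x hx
    rw [hx]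
    rfl
  rw [h]
  exact ((B.lpPairing volume q q.conjExponent).flip (hφL.toLp φ)).continuous

theorem W0sub_integral_by_parts {n : ℕ} {D : Set (Fin n → ℝ)} {q : ℝ≥0∞} [Fact (1 ≤ q)]
    {φ : (Fin n → ℝ) → ℝ} (hφ : IsTestFun univ φ) (i : Fin n) (f : W0sub q D) :
    ∫ x, (f : Vsp n q) x 0 * pder i φ x = -∫ x, (f : Vsp n q) x i.succ * φ x := by
  refine W0sub_induction (D := D) (q := q)
    (P := fun f => ∫ x, f x 0 * pder i φ x = -∫ x, f x i.succ * φ x) ?_ ?_ f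
  · exact isClosed_eq
      (continuous_integral_coord_mul 0 (hφ.continuous_pder i) (hφ.hasCompactSupport_pder i))
      (continuous_integral_coord_mul i.succ hφ.1.continuous hφ.2.1).neg
  · intro f u hu hfu
    have h0 : ∫ x, f x 0 * pder i φ x = ∫ x, u x * fderiv ℝ φ x (Pi.single i 1) := by
      apply integral_congr_ae
      filter_upwards [hfu] with x hx
      rw [hx]
      rfl
    have h1 : ∫ x, f x i.succ * φ x = ∫ x, fderiv ℝ u x (Pi.single i 1) * φ x := by
      apply integral_congr_ae
      filter_upwards [hfu] with x hx
      rw [hx]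
      rfl
    rw [h0, h1]
    have hi : ∀ {v w : (Fin n → ℝ) → ℝ}, Continuous v → Continuous w → HasCompactSupport w →
        Integrable fun x => v x * w x := fun hv hw hc =>
      (hv.mul hw).integrable_of_hasCompactSupport hc.mul_left
    exact integral_mul_fderiv_eq_neg_fderiv_mul_of_integrable
      (hi (hu.continuous_pder i) hφ.1.continuous hφ.2.1)
      (hi hu.1.continuous (hφ.continuous_pder i) (hφ.hasCompactSupport_pder i))
      (hi hu.1.continuous hφ.1.continuous hφ.2.1)
      (fun x _ => hu.differentiable x) (fun x _ => hφ.differentiable x)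

/-- The gradient is closable: the Sobolev embedding is injective. -/
theorem eq_zero_of_SobolevEmb_eq_zero {n : ℕ} {D : Set (Fin n → ℝ)} {q : ℝ≥0∞} [hq : Fact (1 ≤ q)]
    {f : W0sub q D} (hf : SobolevEmb q D f = 0) : f = 0 := by
  have h0 : ∀ᵐ x, (f : Vsp n q) x 0 = 0 := by
    have h1 := ContinuousLinearMap.coeFn_compLpL (𝕜' := ℝ) (proj0 n q) (f : Vsp n q)
    have h2 : ((proj0 n q).compLpL q volume (f : Vsp n q)) = 0 := hf
    rw [h2] at h1
    filter_upwards [h1, Lp.coeFn_zero ℝ q (volume : Measure (Fin n → ℝ))] with x hx hx0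
    rw [hx0] at hx
    exact hx.symm
  have hs : ∀ i : Fin n, ∀ᵐ x, (f : Vsp n q) x i.succ = 0 := by
    intro i
    refine ae_eq_zero_of_integral_contDiff_smul_eq_zero ?_ ?_
    · have h := (PiLp.proj q (fun _ : Fin (n + 1) => ℝ) i.succ (𝕜 := ℝ)).comp_memLp (f : Vsp n q)
      exact h.locallyIntegrable hq.out
    · intro g hg hgc
      have h := W0sub_integral_by_parts (D := D) (q := q) ⟨hg, hgc, subset_univ _⟩ i f
      have h' : ∫ x, (f : Vsp n q) x 0 * pder i g x = 0 := by
        apply integral_eq_zero_of_ae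
        filter_upwards [h0] with x hx
        simp [hx]
      rw [h', eq_comm, neg_eq_zero] at h
      simpa [smul_eq_mul, mul_comm] using h
  apply Subtype.ext
  apply Lp.ext
  filter_upwards [h0, ae_all_iff.2 hs, Lp.coeFn_zero (PiLp q fun _ : Fin (n + 1) => ℝ) q
    (volume : Measure (Fin n → ℝ))] with x hx hxs hz
  ext j
  refine Fin.cases ?_ (fun i => ?_) j
  · simpa [hz] using hx
  · simpa [hz] using hxs i

/-- The lower bound for the Rayleigh quotient on the strip. -/
theorem poincare_strip {n k : ℕ} {p : ℝ} [Fact (1 ≤ ENNReal.ofReal p)] (hp : 1 < p)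
    {a b : Fin n → ℝ} (hab : ∀ i : Fin n, k ≤ (i : ℕ) → a i < b i)
    (f : W0sub (ENNReal.ofReal p) (stripDomain n k a b)) :
    piP p ^ p * (p - 1) *
        (∑ i ∈ Finset.univ.filter (fun i : Fin n => k ≤ (i : ℕ)), (b i - a i) ^ (-p)) *
        ‖SobolevEmb (ENNReal.ofReal p) (stripDomain n k a b) f‖ ^ p ≤
      ‖SobolevGrad (ENNReal.ofReal p) (stripDomain n k a b) f‖ ^ p := by
  have hp0 : 0 < p := by linarith
  refine W0sub_induction (D := stripDomain n k a b) (q := ENNReal.ofReal p)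
    (P := fun f => piP p ^ p * (p - 1) *
        (∑ i ∈ Finset.univ.filter (fun i : Fin n => k ≤ (i : ℕ)), (b i - a i) ^ (-p)) *
        ‖(proj0 n (ENNReal.ofReal p)).compLpL (ENNReal.ofReal p) volume f‖ ^ p ≤
      ‖(projGrad n (ENNReal.ofReal p)).compLpL (ENNReal.ofReal p) volume f‖ ^ p) ?_ ?_ f
  · exact isClosed_le
      (continuous_const.mul
        ((ContinuousLinearMap.continuous _).norm.rpow_const fun _ => Or.inr hp0.le))
      ((ContinuousLinearMap.continuous _).norm.rpow_const fun _ => Or.inr hp0.le)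
  · intro f u hu hfu
    rw [norm_proj0_rpow_jet hp hfu, norm_projGrad_rpow_jet hp hu hfu, Finset.mul_sum,
      Finset.sum_mul]
    calc _ ≤ ∑ i ∈ Finset.univ.filter (fun i : Fin n => k ≤ (i : ℕ)), ∫ x, |pder i u x| ^ p :=
          Finset.sum_le_sum fun i hi =>
            poincare_coord hp hu (Finset.mem_filter.1 hi).2 (hab i (Finset.mem_filter.1 hi).2)
      _ ≤ _ := Finset.sum_le_sum_of_subset_of_nonneg (Finset.filter_subset _ _) fun i _ _ =>
          integral_nonneg fun x => by positivity

/-- A tensor product of one-dimensional test functions. -/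
theorem isTestFun_prod {n k : ℕ} {a b : Fin n → ℝ} {φ : Fin n → ℝ → ℝ}
    (hφ : ∀ i, ContDiff ℝ (⊤ : ℕ∞) (φ i)) (hc : ∀ i, HasCompactSupport (φ i))
    (hs : ∀ i : Fin n, k ≤ (i : ℕ) → tsupport (φ i) ⊆ Ioo (a i) (b i)) :
    IsTestFun (stripDomain n k a b) fun x => ∏ i, φ i (x i) := by
  have hsub : tsupport (fun x : Fin n → ℝ => ∏ i, φ i (x i)) ⊆ univ.pi fun i => tsupport (φ i) := by
    refine closure_minimal (fun x hx i _ => subset_tsupport _ ?_)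
      (isClosed_set_pi fun i _ => isClosed_tsupport _)
    exact Finset.prod_ne_zero_iff.1 hx i (Finset.mem_univ i)
  refine ⟨contDiff_prod fun i _ => (hφ i).comp (contDiff_apply ℝ ℝ i),
    (isCompact_univ_pi fun i => (hc i).isCompact).of_isClosed_subset (isClosed_tsupport _) hsub,
    fun x hx i hi => hs i hi (hsub hx i (mem_univ i))⟩

theorem pder_prod {n : ℕ} {φ : Fin n → ℝ → ℝ} (hφ : ∀ i, ContDiff ℝ 1 (φ i)) (i : Fin n)
    (x : Fin n → ℝ) :
    pder i (fun x => ∏ j, φ j (x j)) x = ∏ j, (Function.update φ i (deriv (φ i))) j (x j) := by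
  have hd : Differentiable ℝ fun x : Fin n → ℝ => ∏ j, φ j (x j) :=
    (contDiff_prod fun j _ => (hφ j).comp (contDiff_apply ℝ ℝ j)).differentiable one_ne_zero
  have h1 := hasDerivAt_comp_update hd i x (x i)
  have hval : ∀ t, ∏ j, φ j (Function.update x i t j) =
      φ i t * ∏ j ∈ Finset.univ.erase i, φ j (x j) := by
    intro t
    rw [← Finset.mul_prod_erase _ _ (Finset.mem_univ i), Function.update_self]
    congr 1
    exact Finset.prod_congr rfl fun j hj => by rw [Function.update_of_ne (Finset.ne_of_mem_erase hj)]
  have h2 : HasDerivAt (fun t => ∏ j, φ j (Function.update x i t j))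
      (deriv (φ i) (x i) * ∏ j ∈ Finset.univ.erase i, φ j (x j)) (x i) := by
    simp_rw [hval]
    exact ((hφ i).differentiable one_ne_zero _).hasDerivAt.mul_const _
  rw [Function.update_eq_self] at h1
  rw [h1.unique h2, ← Finset.mul_prod_erase _ _ (Finset.mem_univ i), Function.update_self]
  congr 1
  exact Finset.prod_congr rfl fun j hj => by rw [Function.update_of_ne (Finset.ne_of_mem_erase hj)]

theorem integral_abs_prod_rpow {n : ℕ} (φ : Fin n → ℝ → ℝ) (p : ℝ) :
    ∫ x : Fin n → ℝ, |∏ i, φ i (x i)| ^ p = ∏ i, ∫ t, |φ i t| ^ p := by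
  rw [← integral_fintype_prod_volume_eq_prod]
  congr 1 with x
  rw [Finset.abs_prod, Real.finsetProd_rpow _ _ fun i _ => abs_nonneg _]

/-- Test functions on the line, with small Rayleigh quotient. -/
theorem exists_small_rayleigh_quotient {p ε : ℝ} (hp : 1 < p) (hε : 0 < ε) :
    ∃ v : ℝ → ℝ, ContDiff ℝ (⊤ : ℕ∞) v ∧ HasCompactSupport v ∧ 0 < ∫ x, |v x| ^ p ∧
      ∫ x, |deriv v x| ^ p ≤ ε * ∫ x, |v x| ^ p := by
  have ht : Tendsto (fun R : ℝ => piP p ^ p * (p - 1) * (R - 0) ^ (-p)) atTop (𝓝 0) := by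
    simpa using (tendsto_rpow_neg_atTop (by linarith : 0 < p)).const_mul (piP p ^ p * (p - 1))
  obtain ⟨R, hR, hR0⟩ := ((ht.eventually_lt_const (half_pos hε)).and (eventually_gt_atTop 0)).exists
  obtain ⟨v, hv, hc, -, hpos, hle⟩ := exists_almost_extremal_Ioo hp hR0 (half_pos hε)
  refine ⟨v, hv, hc, hpos, hle.trans ?_⟩
  gcongr
  linarith

/-- Tensor products of one-dimensional almost extremal functions are almost extremal. -/
theorem exists_almost_extremal_strip {n k : ℕ} {p : ℝ} (hp : 1 < p) {a b : Fin n → ℝ}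
    (hab : ∀ i : Fin n, k ≤ (i : ℕ) → a i < b i) {ε : ℝ} (hε : 0 < ε) :
    ∃ u, IsTestFun (stripDomain n k a b) u ∧ 0 < ∫ x, |u x| ^ p ∧
      ∑ i, ∫ x, |pder i u x| ^ p ≤ (piP p ^ p * (p - 1) *
        (∑ i ∈ Finset.univ.filter (fun i : Fin n => k ≤ (i : ℕ)), (b i - a i) ^ (-p)) + n * ε) *
        ∫ x, |u x| ^ p := by
  have hφ : ∀ i : Fin n, ∃ v : ℝ → ℝ, ContDiff ℝ (⊤ : ℕ∞) v ∧ HasCompactSupport v ∧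
      (k ≤ (i : ℕ) → tsupport v ⊆ Ioo (a i) (b i)) ∧ 0 < ∫ x, |v x| ^ p ∧
      ∫ x, |deriv v x| ^ p ≤
        ((if k ≤ (i : ℕ) then piP p ^ p * (p - 1) * (b i - a i) ^ (-p) else 0) + ε) *
          ∫ x, |v x| ^ p := by
    intro i
    by_cases hi : k ≤ (i : ℕ)
    · obtain ⟨v, h1, h2, h3, h4, h5⟩ := exists_almost_extremal_Ioo hp (hab i hi) hε
      exact ⟨v, h1, h2, fun _ => h3, h4, by simpa [hi] using h5⟩
    · obtain ⟨v, h1, h2, h4, h5⟩ := exists_small_rayleigh_quotient hp hε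
      exact ⟨v, h1, h2, fun h => absurd h hi, h4, by simpa [hi] using h5⟩
  choose φ h1 h2 h3 h4 h5 using hφ
  refine ⟨fun x => ∏ i, φ i (x i), isTestFun_prod h1 h2 h3, ?_, ?_⟩
  · rw [integral_abs_prod_rpow]
    exact Finset.prod_pos fun i _ => h4 i
  have key : ∀ i, ∫ x, |pder i (fun x => ∏ i, φ i (x i)) x| ^ p ≤
      ((if k ≤ (i : ℕ) then piP p ^ p * (p - 1) * (b i - a i) ^ (-p) else 0) + ε) *
        ∏ j, ∫ x, |φ j x| ^ p := by
    intro i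
    simp_rw [pder_prod (fun i => (h1 i).of_le (by simp))]
    rw [integral_abs_prod_rpow, ← Finset.mul_prod_erase _ _ (Finset.mem_univ i),
      ← Finset.mul_prod_erase _ _ (Finset.mem_univ i), Function.update_self, ← mul_assoc]
    have he : ∏ j ∈ Finset.univ.erase i, ∫ t, |Function.update φ i (deriv (φ i)) j t| ^ p =
        ∏ j ∈ Finset.univ.erase i, ∫ t, |φ j t| ^ p :=
      Finset.prod_congr rfl fun j hj => by rw [Function.update_of_ne (Finset.ne_of_mem_erase hj)]
    rw [he]
    exact mul_le_mul_of_nonneg_right (h5 i) (Finset.prod_nonneg fun j _ => (h4 j).le)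
  rw [integral_abs_prod_rpow]
  refine (Finset.sum_le_sum fun i _ => key i).trans_eq ?_
  rw [← Finset.sum_mul, Finset.sum_add_distrib, ← Finset.sum_filter, Finset.mul_sum]
  simp

theorem exists_W0sub_of_isTestFun {n : ℕ} {p : ℝ} [Fact (1 ≤ ENNReal.ofReal p)] (hp : 1 < p)
    {D : Set (Fin n → ℝ)} {u : (Fin n → ℝ) → ℝ} (hu : IsTestFun D u) :
    ∃ f : W0sub (ENNReal.ofReal p) D,
      ‖SobolevEmb (ENNReal.ofReal p) D f‖ ^ p = ∫ x, |u x| ^ p ∧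
      ‖SobolevGrad (ENNReal.ofReal p) D f‖ ^ p = ∑ i, ∫ x, |pder i u x| ^ p := by
  have hL := hu.memLp_jet (ENNReal.ofReal p)
  have hfu := hL.coeFn_toLp
  exact ⟨⟨hL.toLp _, subset_closure (Submodule.subset_span ⟨u, hu, hfu⟩)⟩,
    norm_proj0_rpow_jet hp hfu, norm_projGrad_rpow_jet hp hu hfu⟩

/-- The infimum of the Rayleigh quotient
`‖ |∇u|_{ℓ^p} ‖_{L^p(D)}^p / ‖u‖_{L^p(D)}^p` over nonzero `u ∈ W₀^{1,p}(D)`, for the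
strip-like domain `D = ℝᵏ × ∏_{i=1}^{n-k} (aᵢ,bᵢ)`, equals
`π_p^p (p-1) ∑_{i=1}^{n-k} (bᵢ-aᵢ)^{-p}`. -/
theorem rayleigh_inf_stripDomain
    (n k : ℕ) (hn : 2 ≤ n) (hk : k < n) (p : ℝ) (hp : 1 < p)
    (a b : Fin n → ℝ) (hab : ∀ i : Fin n, k ≤ (i : ℕ) → a i < b i) :
    letI : Fact (1 ≤ ENNReal.ofReal p) := ⟨ENNReal.one_le_ofReal.mpr hp.le⟩
    sInf {r : ℝ | ∃ u : W0sub (ENNReal.ofReal p) (stripDomain n k a b), u ≠ 0 ∧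
        r = ‖SobolevGrad (ENNReal.ofReal p) (stripDomain n k a b) u‖ ^ p /
            ‖SobolevEmb (ENNReal.ofReal p) (stripDomain n k a b) u‖ ^ p} =
      piP p ^ p * (p - 1) *
        ∑ i ∈ Finset.univ.filter (fun i : Fin n => k ≤ (i : ℕ)), (b i - a i) ^ (-p) := by
  have hp0 : 0 < p := by linarith
  have hfact : Fact (1 ≤ ENNReal.ofReal p) := ⟨ENNReal.one_le_ofReal.mpr hp.le⟩
  have norm_pos : ∀ u : W0sub (ENNReal.ofReal p) (stripDomain n k a b), u ≠ 0 →
      0 < ‖SobolevEmb (ENNReal.ofReal p) (stripDomain n k a b) u‖ ^ p := fun u hu =>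
    Real.rpow_pos_of_pos (norm_pos_iff.2 fun h => hu (eq_zero_of_SobolevEmb_eq_zero h)) p
  have approx : ∀ ε : ℝ, 0 < ε → ∃ u : W0sub (ENNReal.ofReal p) (stripDomain n k a b), u ≠ 0 ∧
      ‖SobolevGrad (ENNReal.ofReal p) (stripDomain n k a b) u‖ ^ p /
        ‖SobolevEmb (ENNReal.ofReal p) (stripDomain n k a b) u‖ ^ p ≤
      piP p ^ p * (p - 1) *
        (∑ i ∈ Finset.univ.filter (fun i : Fin n => k ≤ (i : ℕ)), (b i - a i) ^ (-p)) + n * ε := by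
    intro ε hε
    obtain ⟨u, hu, hpos, hle⟩ := exists_almost_extremal_strip hp hab hε
    obtain ⟨f, hf0, hf1⟩ := exists_W0sub_of_isTestFun hp hu
    refine ⟨f, ?_, ?_⟩
    · rintro rfl
      rw [map_zero, norm_zero, Real.zero_rpow hp0.ne'] at hf0
      exact hpos.ne hf0
    · rw [hf0, hf1, div_le_iff₀ hpos]
      exact hle
  have hn0 : (0 : ℝ) < n := by exact_mod_cast (by omega : 0 < n)
  refine csInf_eq_of_forall_ge_of_forall_gt_exists_lt ?_ ?_ ?_
  · obtain ⟨u, hu, -⟩ := approx 1 one_pos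
    exact ⟨_, u, hu, rfl⟩
  · rintro r ⟨u, hu, rfl⟩
    rw [le_div_iff₀ (norm_pos u hu)]
    exact poincare_strip hp hab u
  · intro w hw
    obtain ⟨u, hu, hle⟩ := approx _ (div_pos (half_pos (sub_pos.2 hw)) hn0)
    refine ⟨_, ⟨u, hu, rfl⟩, hle.trans_lt ?_⟩
    rw [mul_div_cancel₀ _ hn0.ne']
    linarith
end

section
/- Let p ∈ (1,∞), n ≥ 2, k ∈ {0,1,…,n−1}, and −∞ < a_i < b_i < ∞ for i = 1,…,n−k; set D = ℝ^k × ∏_{i=1}^{n−k}(a_i,b_i) ⊆ ℝⁿ, with coordinates written (x,y) ∈ ℝ^k × ∏_{i=1}^{n−k}(a_i,b_i). Then for every u ∈ C_0^∞(D) and every i ∈ {1,…,n−k}, ‖∂u/∂y_i‖_{L^p(D)}^p ≥ π_p^p (p−1) (b_i−a_i)^{−p} ‖u‖_{L^p(D)}^p. -/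
open MeasureTheory ENNReal Set Filter Topology

/-- The primitive of `r ↦ 1 / ((p - 1) (1 + |r| ^ q))` that vanishes at `0`. -/
noncomputable def riccatiTime (p q v : ℝ) : ℝ :=
  ∫ r in (0 : ℝ)..v, ((p - 1) * (1 + |r| ^ q))⁻¹

lemma riccati_speed_pos {p : ℝ} (hp : 1 < p) (q r : ℝ) : 0 < (p - 1) * (1 + |r| ^ q) :=
  mul_pos (by linarith) (by positivity)

lemma hasDerivAt_riccatiTime {p q : ℝ} (hp : 1 < p) (hq : 0 < q) (v : ℝ) :
    HasDerivAt (riccatiTime p q) ((p - 1) * (1 + |v| ^ q))⁻¹ v := by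
  have hc : Continuous fun r : ℝ => ((p - 1) * (1 + |r| ^ q))⁻¹ :=
    (continuous_const.mul (continuous_const.add
      (continuous_abs.rpow_const fun _ => Or.inr hq.le))).inv₀
        fun r => (riccati_speed_pos hp q r).ne'
  exact intervalIntegral.integral_hasDerivAt_right (hc.intervalIntegrable _ _)
    (hc.stronglyMeasurableAtFilter _ _) hc.continuousAt

lemma riccatiTime_neg (p q v : ℝ) : riccatiTime p q (-v) = -riccatiTime p q v := by
  have h := intervalIntegral.integral_comp_neg (a := 0) (b := v)
    (fun r : ℝ => ((p - 1) * (1 + |r| ^ q))⁻¹)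
  simp only [abs_neg, neg_zero] at h
  rw [riccatiTime, riccatiTime, h, intervalIntegral.integral_symm]

lemma hasDerivAt_riccatiTime_comp {p q : ℝ} (hpq : p.HolderConjugate q) {s : ℝ}
    (hs : s ∈ Ioo (0 : ℝ) 1) :
    HasDerivAt (fun s => riccatiTime p q ((1 - s ^ p) ^ (1 / q) * s ^ (-(p - 1))))
      (-(1 - s ^ p) ^ (-1 / p)) s := by
  have hp := hpq.lt
  have hp0 : 0 < p := hpq.pos
  have hq0 : 0 < q := hpq.symm.pos
  have hX : 0 < 1 - s ^ p := by
    have := Real.rpow_lt_one hs.1.le hs.2 hp0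
    linarith
  have h1 : HasDerivAt (fun s : ℝ => 1 - s ^ p) (-(p * s ^ (p - 1))) s :=
    (Real.hasDerivAt_rpow_const (Or.inl hs.1.ne')).const_sub 1
  have h2 := h1.rpow_const (p := 1 / q) (Or.inl hX.ne')
  have h3 : HasDerivAt (fun s : ℝ => s ^ (-(p - 1))) _ s :=
    Real.hasDerivAt_rpow_const (Or.inl hs.1.ne')
  have h4 := (hasDerivAt_riccatiTime hp hq0
    ((1 - s ^ p) ^ (1 / q) * s ^ (-(p - 1)))).comp s (h2.mul h3)
  refine h4.congr_deriv ?_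
  have hqp : (p - 1) * q = p := hpq.sub_one_mul_conj
  have e1 : |(1 - s ^ p) ^ (1 / q) * s ^ (-(p - 1))| ^ q = (1 - s ^ p) * (s ^ p)⁻¹ := by
    rw [abs_of_nonneg (by have := hs.1; positivity), Real.mul_rpow (by positivity)
      (by have := hs.1; positivity), ← Real.rpow_mul hX.le, ← Real.rpow_mul hs.1.le,
      one_div_mul_cancel hq0.ne', Real.rpow_one, neg_mul, hqp, Real.rpow_neg hs.1.le]
  have hsp : 0 < s ^ p := Real.rpow_pos_of_pos hs.1 p
  have e2 : (1 - s ^ p) ^ (1 / q) = (1 - s ^ p) ^ (-1 / p) * (1 - s ^ p) := by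
    rw [← Real.rpow_add_one hX.ne']
    congr 1
    have := hpq.inv_add_inv_eq_one
    simp only [div_eq_mul_inv]; linarith
  have e3 : (1 - s ^ p) ^ (1 / q - 1) = (1 - s ^ p) ^ (-1 / p) := by
    congr 1
    have := hpq.inv_add_inv_eq_one
    simp only [div_eq_mul_inv]; linarith
  have e4 : s ^ (p - 1) = s ^ p * s⁻¹ := by
    rw [Real.rpow_sub_one hs.1.ne', div_eq_mul_inv]
  have e5 : s ^ (-(p - 1)) = (s ^ p)⁻¹ * s := by
    rw [Real.rpow_neg hs.1.le, e4]; field_simp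
  have e6 : s ^ (-(p - 1) - 1) = (s ^ p)⁻¹ := by
    rw [Real.rpow_sub_one hs.1.ne', e5, mul_div_assoc, div_self hs.1.ne', mul_one]
  rw [e1, e2, e3, e4, e5, e6]
  have hs0 := hs.1.ne'
  have hp1 : p - 1 ≠ 0 := by linarith
  have hq' : q = p / (p - 1) := by field_simp; linarith
  rw [hq']
  field_simp
  ring

lemma riccatiTime_eq_integral {p q : ℝ} (hpq : p.HolderConjugate q)
    (hint : IntervalIntegrable (fun s : ℝ => (1 - s ^ p) ^ (-1 / p)) volume 0 1)
    {s : ℝ} (hs : s ∈ Ioo (0 : ℝ) 1) :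
    riccatiTime p q ((1 - s ^ p) ^ (1 / q) * s ^ (-(p - 1))) =
      ∫ r in s..1, (1 - r ^ p) ^ (-1 / p) := by
  have hq0 : 0 < q := hpq.symm.pos
  have hcT : Continuous (riccatiTime p q) :=
    continuous_iff_continuousAt.2 fun v => (hasDerivAt_riccatiTime hpq.lt hq0 v).continuousAt
  have hint' : IntervalIntegrable (fun s : ℝ => (1 - s ^ p) ^ (-1 / p)) volume s 1 :=
    hint.mono_set (by
      rw [uIcc_of_le hs.2.le, uIcc_of_le zero_le_one]; exact Icc_subset_Icc_left hs.1.le)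
  have h := intervalIntegral.integral_eq_sub_of_hasDerivAt_of_le hs.2.le
    (f := fun s => riccatiTime p q ((1 - s ^ p) ^ (1 / q) * s ^ (-(p - 1))))
    (f' := fun s => -(1 - s ^ p) ^ (-1 / p)) ?_
    (fun r hr => hasDerivAt_riccatiTime_comp hpq ⟨hs.1.trans hr.1, hr.2⟩) hint'.neg
  · rw [intervalIntegral.integral_neg] at h
    have h0 : riccatiTime p q 0 = 0 := by simp [riccatiTime]
    simp only [Real.one_rpow, sub_self, Real.zero_rpow (one_div_pos.2 hq0).ne', zero_mul, h0] at h
    linarith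
  · refine hcT.comp_continuousOn (ContinuousOn.mul ?_ ?_)
    · exact ((continuous_const.sub (Real.continuous_rpow_const hpq.pos.le)).rpow_const
        fun _ => Or.inr (one_div_pos.2 hq0).le).continuousOn
    · exact ContinuousOn.rpow_const continuousOn_id fun r hr => Or.inl (hs.1.trans_le hr.1).ne'

lemma exists_le_riccatiTime {p q : ℝ} (hpq : p.HolderConjugate q)
    (hint : IntervalIntegrable (fun s : ℝ => (1 - s ^ p) ^ (-1 / p)) volume 0 1)
    {τ : ℝ} (hτ : τ < piP p / 2) : ∃ v, τ ≤ riccatiTime p q v := by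
  have hc : ContinuousOn (fun s : ℝ => ∫ r in (0 : ℝ)..s, (1 - r ^ p) ^ (-1 / p)) (Icc 0 1) := by
    have := intervalIntegral.continuousOn_primitive_interval' hint left_mem_uIcc
    rwa [uIcc_of_le zero_le_one] at this
  have hlim : Tendsto (fun s : ℝ => ∫ r in (0 : ℝ)..s, (1 - r ^ p) ^ (-1 / p))
      (𝓝[Ioo 0 1] 0) (𝓝 0) := by
    have h := (hc 0 (by simp)).mono_left (nhdsWithin_mono _ Ioo_subset_Icc_self)
    simpa using h
  have hpos : 0 < piP p / 2 - τ := by linarith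
  have : (𝓝[Ioo (0 : ℝ) 1] 0).NeBot := by
    rw [nhdsWithin_Ioo_eq_nhdsGT zero_lt_one]; infer_instance
  obtain ⟨s, hlt, hs⟩ := ((hlim.eventually_lt_const hpos).and self_mem_nhdsWithin).exists
  refine ⟨_, le_of_le_of_eq ?_ (riccatiTime_eq_integral hpq hint hs).symm⟩
  have h01 : ∀ {x y : ℝ}, x ∈ Icc (0 : ℝ) 1 → y ∈ Icc (0 : ℝ) 1 →
      IntervalIntegrable (fun s : ℝ => (1 - s ^ p) ^ (-1 / p)) volume x y := fun hx hy =>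
    hint.mono_set (by rw [uIcc_of_le (zero_le_one (α := ℝ))]; exact uIcc_subset_Icc hx hy)
  have hadd := intervalIntegral.integral_add_adjacent_intervals
    (h01 (left_mem_Icc.2 zero_le_one) (Ioo_subset_Icc_self hs))
    (h01 (Ioo_subset_Icc_self hs) (right_mem_Icc.2 zero_le_one))
  simp only [piP] at hlt hadd ⊢
  linarith

/-- The Riccati equation `g' = (p - 1) (1 + |g| ^ q)` has a solution on `(-π_p/2, π_p/2)`. -/
lemma exists_riccati_solution {p q : ℝ} (hpq : p.HolderConjugate q)
    (hint : IntervalIntegrable (fun s : ℝ => (1 - s ^ p) ^ (-1 / p)) volume 0 1) :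
    ∃ g : ℝ → ℝ, ∀ τ ∈ Ioo (-(piP p / 2)) (piP p / 2),
      HasDerivAt g ((p - 1) * (1 + |g τ| ^ q)) τ := by
  have hp := hpq.lt
  have hT := hasDerivAt_riccatiTime hp hpq.symm.pos
  have hcT : Continuous (riccatiTime p q) :=
    continuous_iff_continuousAt.2 fun v => (hT v).continuousAt
  have hmono : StrictMono (riccatiTime p q) := strictMono_of_deriv_pos fun v => by
    rw [(hT v).deriv]; exact inv_pos.2 (riccati_speed_pos hp q v)
  have hsurj : ∀ τ ∈ Ioo (-(piP p / 2)) (piP p / 2), ∃ v, riccatiTime p q v = τ := by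
    intro τ hτ
    obtain ⟨v, hv⟩ := exists_le_riccatiTime hpq hint hτ.2
    obtain ⟨w, hw⟩ := exists_le_riccatiTime hpq hint (τ := -τ) (by linarith [hτ.1])
    exact mem_range_of_exists_le_of_exists_ge hcT
      ⟨-w, by rw [riccatiTime_neg]; linarith⟩ ⟨v, hv⟩
  refine ⟨Function.invFun (riccatiTime p q), fun τ hτ => ?_⟩
  have hinv : ∀ σ ∈ Ioo (-(piP p / 2)) (piP p / 2),
      riccatiTime p q (Function.invFun (riccatiTime p q) σ) = σ :=
    fun σ hσ => Function.invFun_eq (hsurj σ hσ)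
  have hleft := Function.leftInverse_invFun hmono.injective
  have hnhds := Ioo_mem_nhds hτ.1 hτ.2
  have hg : ContinuousAt (Function.invFun (riccatiTime p q)) τ := by
    refine StrictMonoOn.continuousAt_of_image_mem_nhds
      (s := Ioo (-(piP p / 2)) (piP p / 2)) ?_ hnhds ?_
    · intro x hx y hy hxy
      rw [← hmono.lt_iff_lt, hinv x hx, hinv y hy]
      exact hxy
    · have : riccatiTime p q ⁻¹' Ioo (-(piP p / 2)) (piP p / 2) ∈
          𝓝 (Function.invFun (riccatiTime p q) τ) :=
        hcT.continuousAt.preimage_mem_nhds (by rwa [hinv τ hτ])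
      exact mem_of_superset this fun v hv => ⟨_, hv, hleft v⟩
  have h := HasDerivAt.of_local_left_inverse hg (hT _)
    (inv_pos.2 (riccati_speed_pos hp q _)).ne' (eventually_of_mem hnhds hinv)
  rwa [inv_inv] at h

lemma riccati_young {p q : ℝ} (hpq : p.HolderConjugate q) {c : ℝ} (hc : 0 < c) (g x y : ℝ) :
    -(c ^ (p - 1) * ((p - 1) * (1 + |g| ^ q) * c)) * |x| ^ p +
      -(c ^ (p - 1) * g) * (p * |x| ^ (p - 2) * x * y) ≤
      |y| ^ p - (p - 1) * c ^ p * |x| ^ p := by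
  have hp := hpq.pos
  have hY := Real.young_inequality_of_nonneg (abs_nonneg y)
    (by positivity : 0 ≤ c ^ (p - 1) * |g| * |x| ^ (p - 1)) hpq
  have hpow : (c ^ (p - 1) * |g| * |x| ^ (p - 1)) ^ q = c ^ p * |g| ^ q * |x| ^ p := by
    rw [Real.mul_rpow (by positivity) (by positivity), Real.mul_rpow (by positivity)
      (by positivity), ← Real.rpow_mul hc.le, ← Real.rpow_mul (abs_nonneg x), hpq.sub_one_mul_conj]
  have hcp : c ^ (p - 1) * c = c ^ p := by
    rw [← Real.rpow_add_one hc.ne', sub_add_cancel]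
  have hx : |x| ^ (p - 2) * |x| = |x| ^ (p - 1) := by
    rcases eq_or_ne x 0 with rfl | h
    · simp [Real.zero_rpow hpq.sub_one_pos.ne']
    · rw [← Real.rpow_add_one (abs_ne_zero.2 h)]; congr 1; ring
  have hcross : -(c ^ (p - 1) * g) * (p * |x| ^ (p - 2) * x * y) ≤
      p * (|y| * (c ^ (p - 1) * |g| * |x| ^ (p - 1))) := by
    refine (le_abs_self _).trans_eq ?_
    rw [← hx]
    simp only [abs_mul, abs_neg, abs_of_pos hp, abs_of_pos (Real.rpow_pos_of_pos hc (p - 1)),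
      abs_of_nonneg (Real.rpow_nonneg (abs_nonneg x) (p - 2))]
    ring
  have hpq' : p / q = p - 1 := hpq.div_conj_eq_sub_one
  have hmul := mul_le_mul_of_nonneg_left hY hp.le
  have e : p * (|y| ^ p / p + c ^ p * |g| ^ q * |x| ^ p / q) =
      |y| ^ p + (p - 1) * (c ^ p * |g| ^ q * |x| ^ p) := by
    rw [← hpq']; field_simp
  rw [hpow, e] at hmul
  have e' : -(c ^ (p - 1) * ((p - 1) * (1 + |g| ^ q) * c)) * |x| ^ p =
      -((p - 1) * (1 + |g| ^ q)) * c ^ p * |x| ^ p := by rw [← hcp]; ring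
  rw [e']
  linarith

lemma piP_nonneg {p : ℝ} (hp : 0 < p) : 0 ≤ piP p := by
  refine mul_nonneg zero_le_two (intervalIntegral.integral_nonneg zero_le_one fun s hs => ?_)
  have := Real.rpow_le_one hs.1 hs.2 hp.le
  exact Real.rpow_nonneg (by linarith) _

/-- The sharp one-dimensional Poincaré inequality on an interval. -/
lemma poincare_interval {p : ℝ} (hp : 1 < p) {a b α β : ℝ} (hα : a < α) (hαβ : α ≤ β)
    (hβ : β < b) {u u' : ℝ → ℝ} (hu : ∀ t, HasDerivAt u (u' t) t) (hu' : Continuous u')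
    (h0 : ∀ t ∉ Ioo α β, u t = 0) :
    0 ≤ ∫ t, (|u' t| ^ p - piP p ^ p * (p - 1) * (b - a) ^ (-p) * |u t| ^ p) := by
  have hp0 : 0 < p := by linarith
  have hab : 0 < b - a := by linarith
  rcases (piP_nonneg hp0).eq_or_lt with hpi | hpi
  · rw [← hpi, Real.zero_rpow hp0.ne']
    exact integral_nonneg fun t => by simp only [zero_mul, sub_zero]; positivity
  have hpq := Real.HolderConjugate.conjExponent hp
  have hint : IntervalIntegrable (fun s : ℝ => (1 - s ^ p) ^ (-1 / p)) volume 0 1 := by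
    by_contra h
    rw [piP, intervalIntegral.integral_undef h, mul_zero] at hpi
    exact lt_irrefl _ hpi
  obtain ⟨g, hg⟩ := exists_riccati_solution hpq hint
  have hcu : Continuous u := continuous_iff_continuousAt.2 fun t => (hu t).continuousAt
  have hu0 : ∀ t ∉ Icc α β, u' t = 0 := by
    intro t ht
    refine (hu t).unique ((hasDerivAt_const t (0 : ℝ)).congr_of_eventuallyEq ?_)
    filter_upwards [isClosed_Icc.isOpen_compl.mem_nhds ht] with s hs
    exact h0 s fun h => hs (Ioo_subset_Icc_self h)
  set c := piP p / (b - a) with hc_def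
  have hc : 0 < c := div_pos hpi hab
  have hconst : piP p ^ p * (p - 1) * (b - a) ^ (-p) = (p - 1) * c ^ p := by
    rw [hc_def, Real.div_rpow hpi.le hab.le, Real.rpow_neg hab.le]; ring
  rw [hconst]
  have hcont : Continuous fun t => |u' t| ^ p - (p - 1) * c ^ p * |u t| ^ p :=
    (hu'.abs.rpow_const fun _ => Or.inr hp0.le).sub
      (continuous_const.mul (hcu.abs.rpow_const fun _ => Or.inr hp0.le))
  rw [← setIntegral_eq_integral_of_forall_compl_eq_zero (s := Icc α β) fun t ht => by
    rw [hu0 t ht, h0 t fun h => ht (Ioo_subset_Icc_self h)]; simp [Real.zero_rpow hp0.ne'],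
    integral_Icc_eq_integral_Ioc, ← intervalIntegral.integral_of_le hαβ]
  have hderiv : ∀ t ∈ Icc α β, HasDerivAt
      (fun t => -(c ^ (p - 1) * g (c * (t - (a + b) / 2))) * |u t| ^ p)
      (-(c ^ (p - 1) * ((p - 1) * (1 + |g (c * (t - (a + b) / 2))| ^ p.conjExponent) * c))
        * |u t| ^ p + -(c ^ (p - 1) * g (c * (t - (a + b) / 2))) *
          (p * |u t| ^ (p - 2) * u t * u' t)) t := by
    intro t ht
    have hcab : c * (b - a) = piP p := div_mul_cancel₀ _ hab.ne'
    have h1 : c * (t - (a + b) / 2) ∈ Ioo (-(piP p / 2)) (piP p / 2) := by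
      rw [← hcab]
      constructor
      · nlinarith [ht.1]
      · nlinarith [ht.2]
    have h2 : HasDerivAt (fun t => c * (t - (a + b) / 2)) c t := by
      simpa using ((hasDerivAt_id t).sub_const ((a + b) / 2)).const_mul c
    exact ((((hg _ h1).comp t h2).const_mul _).neg).mul
      ((hasDerivAt_abs_rpow (u t) hp).comp t (hu t))
  have hle := intervalIntegral.sub_le_integral_of_hasDeriv_right_of_le hαβ
    (fun t ht => (hderiv t ht).continuousAt.continuousWithinAt)
    (fun t ht => (hderiv t (Ioo_subset_Icc_self ht)).hasDerivWithinAt)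
    (hcont.integrableOn_Icc) (fun t _ => riccati_young hpq hc _ _ _)
  simpa [h0 α (by simp), h0 β (by simp), Real.zero_rpow hp0.ne'] using hle

lemma IsCompact.exists_subset_Ioo_of_subset_Ioo {K : Set ℝ} (hK : IsCompact K) {a b : ℝ}
    (hab : a < b) (h : K ⊆ Ioo a b) :
    ∃ α β, a < α ∧ α ≤ β ∧ β < b ∧ K ⊆ Ioo α β := by
  rcases K.eq_empty_or_nonempty with rfl | hne
  · exact ⟨(a + b) / 2, (a + b) / 2, by linarith, le_rfl, by linarith, empty_subset _⟩
  obtain ⟨l, hl, hl'⟩ := hK.exists_isLeast hne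
  obtain ⟨r, hr, hr'⟩ := hK.exists_isGreatest hne
  have hlr : l ≤ r := hl' hr
  have h1 := (h hl).1
  have h2 := (h hr).2
  refine ⟨(a + l) / 2, (r + b) / 2, by linarith, by linarith, by linarith, fun x hx => ?_⟩
  have := hl' hx
  have := hr' hx
  constructor <;> linarith

lemma hasDerivAt_insertNth {m : ℕ} (i : Fin (m + 1)) (y : Fin m → ℝ) (t : ℝ) :
    HasDerivAt (fun t : ℝ => (i.insertNth t y : Fin (m + 1) → ℝ)) (Pi.single i 1) t := by
  rw [hasDerivAt_pi]
  intro j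
  rcases Fin.eq_self_or_eq_succAbove i j with rfl | ⟨l, rfl⟩
  · simpa using hasDerivAt_id' t
  · simpa using hasDerivAt_const t (y l)

lemma integral_nonneg_of_forall_integral_insertNth_nonneg {m : ℕ} (i : Fin (m + 1))
    {f : (Fin (m + 1) → ℝ) → ℝ} (hf : Integrable f)
    (h : ∀ y : Fin m → ℝ, 0 ≤ ∫ t : ℝ, f (i.insertNth t y)) : 0 ≤ ∫ x, f x := by
  have hmp := (volume_preserving_piFinSuccAbove (fun _ : Fin (m + 1) => ℝ) i).symm
  have hf' := (hmp.integrable_comp_emb (MeasurableEquiv.measurableEmbedding _)).2 hf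
  rw [Measure.volume_eq_prod] at hf'
  rw [← hmp.integral_comp' f, Measure.volume_eq_prod]
  refine le_of_le_of_eq ?_ (integral_prod_symm _ hf').symm
  exact integral_nonneg h

/-- For every smooth compactly supported `u` on the strip-like domain
`D = ℝᵏ × ∏_{i=1}^{n-k} (aᵢ,bᵢ)` and every bounded coordinate direction `i` (i.e. `i ≥ k`),
one has `‖∂u/∂yᵢ‖_{L^p}^p ≥ π_p^p (p-1) (bᵢ-aᵢ)^{-p} ‖u‖_{L^p}^p`. -/
theorem onedim_poincare_stripDomain
    (n k : ℕ) (hn : 2 ≤ n) (hk : k < n) (p : ℝ) (hp : 1 < p)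
    (a b : Fin n → ℝ) (hab : ∀ i : Fin n, k ≤ (i : ℕ) → a i < b i)
    (u : (Fin n → ℝ) → ℝ) (hu : IsTestFun (stripDomain n k a b) u)
    (i : Fin n) (hi : k ≤ (i : ℕ)) :
    (∫ x : Fin n → ℝ, |pder i u x| ^ p) ≥
      piP p ^ p * (p - 1) * (b i - a i) ^ (-p) * ∫ x : Fin n → ℝ, |u x| ^ p := by
  obtain ⟨hsmooth, hcs, hsupp⟩ := hu
  have hp0 : 0 < p := by linarith
  obtain ⟨m, rfl⟩ : ∃ m, n = m + 1 := ⟨n - 1, by omega⟩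
  have hdiff : Differentiable ℝ u := hsmooth.differentiable (by simp)
  have hcpd : Continuous (pder i u) :=
    (hsmooth.continuous_fderiv (by simp)).clm_apply continuous_const
  have hcspd : HasCompactSupport (pder i u) := hcs.fderiv_apply ℝ (Pi.single i 1)
  have hint : ∀ {v : (Fin (m + 1) → ℝ) → ℝ}, Continuous v → HasCompactSupport v →
      Integrable fun x => |v x| ^ p := fun hv hvs =>
    (hv.abs.rpow_const fun _ => Or.inr hp0.le).integrable_of_hasCompactSupport
      (hvs.comp_left (g := fun r : ℝ => |r| ^ p) (by simp [Real.zero_rpow hp0.ne']))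
  have hi1 := hint hcpd hcspd
  have hi2 := (hint hdiff.continuous hcs).const_mul
    (piP p ^ p * (p - 1) * (b i - a i) ^ (-p))
  rw [ge_iff_le, ← sub_nonneg, ← integral_const_mul, ← integral_sub hi1 hi2]
  obtain ⟨α, β, hα, hαβ, hβ, hK⟩ :=
    (hcs.isCompact.image (continuous_apply i)).exists_subset_Ioo_of_subset_Ioo (hab i hi)
      (by rintro _ ⟨x, hx, rfl⟩; exact hsupp hx i hi)
  refine integral_nonneg_of_forall_integral_insertNth_nonneg i (hi1.sub hi2) fun y => ?_
  have hins : Continuous fun t : ℝ => (i.insertNth t y : Fin (m + 1) → ℝ) :=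
    continuous_iff_continuousAt.2 fun t => (hasDerivAt_insertNth i y t).continuousAt
  refine poincare_interval hp hα hαβ hβ
    (fun t => (hdiff _).hasFDerivAt.comp_hasDerivAt t (hasDerivAt_insertNth i y t))
    (hcpd.comp hins) fun t ht => ?_
  refine image_eq_zero_of_notMem_tsupport (f := u) fun hx => ht ?_
  simpa using hK (mem_image_of_mem _ hx)
end
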